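/- arXiv:math/0012102 — 4 statements merged into one kernel-verified Lean document; each statement's English description precedes it below -/
import Mathlib

section
/- Let A be a free abelian group of rank 2 acting properly discontinuously by semi-simple isometries on a CAT(0) metric space X of covering dimension ≤ 2. Then Π := ⋂_{a ∈ A} Min(a) is the image of an isometric embedding of the Euclidean plane EuclideanSpace ℝ (Fin 2) into X; Π is A-invariant, the restricted action of A on Π is by translations and is cocompact; and Π is the unique A-invariant subset of X that is isometric to the Euclidean plane. -/
/-! Common definitions: geodesic spaces, CAT(0) spaces, covering dimension,
translation length, semi-simple isometries, properly discontinuous actions,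
ℝ-trees, axes, flat strips, and Artin group presentations. -/

/-- The alternating product `x y x y ⋯` of length `k`. -/
def altProd {G : Type*} [Monoid G] (x y : G) : ℕ → G
  | 0 => 1
  | Nat.succ k => x * altProd y x k

/-- `γ` is a geodesic from `x` to `y`, i.e. an isometric map of `[0, dist x y]`
into the space with endpoints `x` and `y`. -/
def IsGeodesic {X : Type*} [MetricSpace X] (x y : X) (γ : ℝ → X) : Prop :=
  γ 0 = x ∧ γ (dist x y) = y ∧
    ∀ s ∈ Set.Icc (0:ℝ) (dist x y), ∀ t ∈ Set.Icc (0:ℝ) (dist x y),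
      dist (γ s) (γ t) = |s - t|

/-- A metric space is geodesic if any two points are joined by a geodesic. -/
def IsGeodesicSpace (X : Type*) [MetricSpace X] : Prop :=
  ∀ x y : X, ∃ γ : ℝ → X, IsGeodesic x y γ

/-- The comparison point at arclength parameter `s` on the Euclidean segment from `x'`
to `y'`, where `d` is the length of the corresponding side of the original triangle. -/
noncomputable def cmpPoint (d : ℝ) (x' y' : EuclideanSpace ℝ (Fin 2)) (s : ℝ) :
    EuclideanSpace ℝ (Fin 2) :=
  x' + (s / d) • (y' - x')

/-- A CAT(0) space: a geodesic metric space in which every geodesic triangle satisfies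
the comparison inequality with respect to a comparison triangle in the Euclidean plane. -/
def IsCAT0 (X : Type*) [MetricSpace X] : Prop :=
  IsGeodesicSpace X ∧
  ∀ (x y z : X) (γ₁ γ₂ : ℝ → X), IsGeodesic x y γ₁ → IsGeodesic x z γ₂ →
    ∀ x' y' z' : EuclideanSpace ℝ (Fin 2),
      dist x' y' = dist x y → dist x' z' = dist x z → dist y' z' = dist y z →
      ∀ s ∈ Set.Icc (0:ℝ) (dist x y), ∀ t ∈ Set.Icc (0:ℝ) (dist x z),
        dist (γ₁ s) (γ₂ t) ≤
          dist (cmpPoint (dist x y) x' y' s) (cmpPoint (dist x z) x' z' t)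

/-- Covering dimension at most `n`: every open cover admits an open refinement in which
every point lies in at most `n + 1` members. -/
def CovDimLE (X : Type*) [TopologicalSpace X] (n : ℕ) : Prop :=
  ∀ U : Set (Set X), (∀ u ∈ U, IsOpen u) → ⋃₀ U = Set.univ →
    ∃ V : Set (Set X), (∀ v ∈ V, IsOpen v) ∧ ⋃₀ V = Set.univ ∧
      (∀ v ∈ V, ∃ u ∈ U, v ⊆ u) ∧
      ∀ x : X, ∃ F : Finset (Set X), F.card ≤ n + 1 ∧ {v | v ∈ V ∧ x ∈ v} ⊆ ↑F

/-- The translation length of a self-map of a metric space. -/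
noncomputable def transLen {X : Type*} [MetricSpace X] (f : X → X) : ℝ :=
  sInf (Set.range fun x => dist x (f x))

/-- A self-map is semi-simple if its translation length is attained. -/
def SemiSimple {X : Type*} [MetricSpace X] (f : X → X) : Prop :=
  ∃ x, dist x (f x) = transLen f

/-- The minset of a self-map of a metric space. -/
def MinSet {X : Type*} [MetricSpace X] (f : X → X) : Set X :=
  {x | dist x (f x) = transLen f}

/-- An action by isometries (given by a homomorphism to the isometry group) is properly
discontinuous if each compact set meets only finitely many of its translates. -/
def ProperlyDisc {G X : Type*} [Group G] [MetricSpace X] (φ : G →* (X ≃ᵢ X)) : Prop :=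
  ∀ K : Set X, IsCompact K → Set.Finite {g : G | ((φ g) '' K ∩ K).Nonempty}

/-- An ℝ-tree: a geodesic metric space satisfying the four-point condition. -/
def IsRTree (T : Type*) [MetricSpace T] : Prop :=
  IsGeodesicSpace T ∧
  ∀ x y z w : T,
    dist x y + dist z w ≤ max (dist x z + dist y w) (dist x w + dist y z)

/-- `L` is an axis of `f`: an `f`-invariant geodesic line along which `f` translates
by its translation length. -/
def IsAxisOf {X : Type*} [MetricSpace X] (f : X → X) (L : Set X) : Prop :=
  ∃ c : ℝ → X, (∀ s t : ℝ, dist (c s) (c t) = |s - t|) ∧ Set.range c = L ∧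
    ∀ t : ℝ, f (c t) = c (t + transLen f)

/-- `j` is an isometric embedding of the Euclidean strip `[0,w] × ℝ` into `X`. -/
def FlatStrip {X : Type*} [MetricSpace X] (w : ℝ) (j : Set.Icc (0:ℝ) w × ℝ → X) : Prop :=
  ∀ p q : Set.Icc (0:ℝ) w × ℝ,
    dist (j p) (j q) = Real.sqrt (((p.1 : ℝ) - (q.1 : ℝ))^2 + (p.2 - q.2)^2)

/-- The set `S` is a flat strip of some positive width `w`, each of whose vertical lines
is an axis of `f`. -/
def StripWithAxes {X : Type*} [MetricSpace X] (f : X → X) (S : Set X) : Prop :=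
  ∃ w : ℝ, 0 < w ∧ ∃ j : Set.Icc (0:ℝ) w × ℝ → X,
    FlatStrip w j ∧ Set.range j = S ∧
    ∀ s : Set.Icc (0:ℝ) w, IsAxisOf f (Set.range fun t : ℝ => j (s, t))

/-- The relations of the Artin group `A(m,n,2)` on generators `a = 0`, `b = 1`, `c = 2`:
`(a,b)_m = (b,a)_m`, `(b,c)_n = (c,b)_n` and `ac = ca`. -/
def artinRel3 (m n : ℕ) : Set (FreeGroup (Fin 3)) :=
  { altProd (FreeGroup.of 0) (FreeGroup.of 1) m *
      (altProd (FreeGroup.of 1) (FreeGroup.of 0) m)⁻¹,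
    altProd (FreeGroup.of 1) (FreeGroup.of 2) n *
      (altProd (FreeGroup.of 2) (FreeGroup.of 1) n)⁻¹,
    FreeGroup.of 0 * FreeGroup.of 2 * (FreeGroup.of 0)⁻¹ * (FreeGroup.of 2)⁻¹ }

/-- The relation of the dihedral-type Artin group `A(m)` on generators `a = 0`, `b = 1`:
`(a,b)_m = (b,a)_m`. -/
def dihedralRel (m : ℕ) : Set (FreeGroup (Fin 2)) :=
  { altProd (FreeGroup.of 0) (FreeGroup.of 1) m *
      (altProd (FreeGroup.of 1) (FreeGroup.of 0) m)⁻¹ }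

open Set

/-- The comparison inequality between a vertex and a point of the opposite side of a triangle:
every pair of points has, for each ratio, a point dividing it, in the sense that Stewart's
identity of Euclidean geometry holds as an inequality. -/
def StewartSpace (Z : Type*) [MetricSpace Z] : Prop :=
  ∀ x y : Z, ∀ t ∈ Icc (0 : ℝ) 1, ∃ u : Z, ∀ z : Z,
    dist z u ^ 2 ≤ (1 - t) * dist z x ^ 2 + t * dist z y ^ 2 - t * (1 - t) * dist x y ^ 2

lemma EuclideanSpace.dist_sq_fin_two (x y : EuclideanSpace ℝ (Fin 2)) :
    dist x y ^ 2 = (x 0 - y 0) ^ 2 + (x 1 - y 1) ^ 2 := by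
  rw [EuclideanSpace.dist_eq, Real.sq_sqrt (by positivity)]
  simp [Fin.sum_univ_two, Real.dist_eq, sq_abs]

lemma exists_comparison_triangle {a b c : ℝ} (ha : 0 ≤ a) (hb : 0 ≤ b) (hc : 0 ≤ c)
    (h₁ : a ≤ b + c) (h₂ : b ≤ a + c) (h₃ : c ≤ a + b) :
    ∃ x y z : EuclideanSpace ℝ (Fin 2), dist x y = a ∧ dist x z = b ∧ dist y z = c := by
  have key : ∀ (p q : EuclideanSpace ℝ (Fin 2)) (r : ℝ), 0 ≤ r →
      (p 0 - q 0) ^ 2 + (p 1 - q 1) ^ 2 = r ^ 2 → dist p q = r := by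
    intro p q r hr h
    rw [← EuclideanSpace.dist_sq_fin_two] at h
    exact (sq_eq_sq₀ dist_nonneg hr).1 h
  rcases ha.eq_or_lt with rfl | ha'
  · obtain rfl : b = c := by linarith
    exact ⟨!₂[0, 0], !₂[0, 0], !₂[b, 0], key _ _ _ le_rfl (by simp),
      key _ _ _ hb (by simp), key _ _ _ hb (by simp)⟩
  · set u := (a ^ 2 + b ^ 2 - c ^ 2) / (2 * a) with hu
    have hua : 2 * a * u = a ^ 2 + b ^ 2 - c ^ 2 := by rw [hu]; field_simp
    have hub : u ^ 2 ≤ b ^ 2 := by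
      apply sq_le_sq'
      · have : 0 ≤ 2 * a * (u + b) := by nlinarith
        have := nonneg_of_mul_nonneg_right this (by positivity)
        linarith
      · have : 0 ≤ 2 * a * (b - u) := by nlinarith
        have := nonneg_of_mul_nonneg_right this (by positivity)
        linarith
    have hv := Real.sq_sqrt (sub_nonneg.2 hub)
    refine ⟨!₂[0, 0], !₂[a, 0], !₂[u, Real.sqrt (b ^ 2 - u ^ 2)], key _ _ _ ha (by simp),
      key _ _ _ hb ?_, key _ _ _ hc ?_⟩
    · simp [hv]
    · simp [hv]; nlinarith

lemma IsCAT0.stewartSpace {X : Type*} [MetricSpace X] (hX : IsCAT0 X) : StewartSpace X := by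
  intro x y t ht
  obtain ⟨γ₁, h₁⟩ := hX.1 x y
  refine ⟨γ₁ (t * dist x y), fun z ↦ ?_⟩
  obtain ⟨γ₂, h₂⟩ := hX.1 x z
  obtain ⟨x', y', z', hxy, hxz, hyz⟩ := exists_comparison_triangle
    (a := dist x y) (b := dist x z) (c := dist y z) dist_nonneg dist_nonneg dist_nonneg
    (by linarith [dist_triangle x z y, dist_comm z y])
    (dist_triangle x y z) (by linarith [dist_triangle y x z, dist_comm y x])
  have h := hX.2 x y z γ₁ γ₂ h₁ h₂ x' y' z' hxy hxz hyz (t * dist x y)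
    ⟨mul_nonneg ht.1 dist_nonneg, mul_le_of_le_one_left dist_nonneg ht.2⟩ (dist x z)
    ⟨dist_nonneg, le_rfl⟩
  have e₁ : cmpPoint (dist x y) x' y' (t * dist x y) = x' + t • (y' - x') := by
    rcases eq_or_ne (dist x y) 0 with h0 | h0
    · have : x' = y' := dist_eq_zero.1 (hxy.trans h0)
      simp [cmpPoint, this]
    · simp [cmpPoint, h0]
  have e₂ : cmpPoint (dist x z) x' z' (dist x z) = z' := by
    rcases eq_or_ne (dist x z) 0 with h0 | h0
    · have : x' = z' := dist_eq_zero.1 (hxz.trans h0)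
      simp [cmpPoint, this]
    · simp [cmpPoint, h0]
  rw [h₂.2.1, e₁, e₂] at h
  generalize γ₁ (t * dist x y) = u at h ⊢
  rw [dist_comm z, dist_comm z x, dist_comm z y, ← hxy, ← hxz, ← hyz]
  refine (pow_le_pow_left₀ dist_nonneg h 2).trans ?_
  simp only [EuclideanSpace.dist_sq_fin_two, PiLp.add_apply, PiLp.smul_apply, PiLp.sub_apply,
    smul_eq_mul]
  exact le_of_eq (by ring)

namespace StewartSpace

variable {Z : Type*} [MetricSpace Z]

open Classical in
/-- The point dividing the pair `x`, `y` in the ratio `t : 1 - t`. -/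
noncomputable def geo (hZ : StewartSpace Z) (x y : Z) (t : ℝ) : Z :=
  if h : t ∈ Icc (0 : ℝ) 1 then (hZ x y t h).choose else x

lemma dist_sq_geo_le (hZ : StewartSpace Z) (x y z : Z) {t : ℝ} (ht : t ∈ Icc (0 : ℝ) 1) :
    dist z (hZ.geo x y t) ^ 2 ≤
      (1 - t) * dist z x ^ 2 + t * dist z y ^ 2 - t * (1 - t) * dist x y ^ 2 := by
  rw [geo, dif_pos ht]
  exact (hZ x y t ht).choose_spec z

lemma dist_left_geo_le (hZ : StewartSpace Z) (x y : Z) {t : ℝ} (ht : t ∈ Icc (0 : ℝ) 1) :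
    dist x (hZ.geo x y t) ≤ t * dist x y := by
  refine abs_le_of_sq_le_sq' ?_ (mul_nonneg ht.1 dist_nonneg) |>.2
  refine (hZ.dist_sq_geo_le x y x ht).trans (le_of_eq ?_)
  rw [dist_self]; ring

lemma dist_geo_right_le (hZ : StewartSpace Z) (x y : Z) {t : ℝ} (ht : t ∈ Icc (0 : ℝ) 1) :
    dist (hZ.geo x y t) y ≤ (1 - t) * dist x y := by
  refine abs_le_of_sq_le_sq' ?_ (mul_nonneg (sub_nonneg.2 ht.2) dist_nonneg) |>.2
  rw [dist_comm]
  refine (hZ.dist_sq_geo_le x y y ht).trans (le_of_eq ?_)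
  rw [dist_self, dist_comm y x]; ring

lemma dist_left_geo (hZ : StewartSpace Z) (x y : Z) {t : ℝ} (ht : t ∈ Icc (0 : ℝ) 1) :
    dist x (hZ.geo x y t) = t * dist x y :=
  le_antisymm (hZ.dist_left_geo_le x y ht) (by
    linarith [hZ.dist_geo_right_le x y ht, dist_triangle x (hZ.geo x y t) y])

lemma dist_geo_right (hZ : StewartSpace Z) (x y : Z) {t : ℝ} (ht : t ∈ Icc (0 : ℝ) 1) :
    dist (hZ.geo x y t) y = (1 - t) * dist x y :=
  le_antisymm (hZ.dist_geo_right_le x y ht) (by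
    linarith [hZ.dist_left_geo_le x y ht, dist_triangle x (hZ.geo x y t) y])

lemma eq_geo (hZ : StewartSpace Z) {x y u : Z} {t : ℝ} (ht : t ∈ Icc (0 : ℝ) 1)
    (h₁ : dist x u ≤ t * dist x y) (h₂ : dist u y ≤ (1 - t) * dist x y) :
    u = hZ.geo x y t := by
  have h := hZ.dist_sq_geo_le x y u ht
  rw [dist_comm u x] at h
  have h₁' := mul_le_mul_of_nonneg_left (pow_le_pow_left₀ dist_nonneg h₁ 2) (sub_nonneg.2 ht.2)
  have h₂' := mul_le_mul_of_nonneg_left (pow_le_pow_left₀ dist_nonneg h₂ 2) ht.1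
  have : dist u (hZ.geo x y t) ^ 2 ≤ 0 := by nlinarith
  exact dist_eq_zero.1 (pow_eq_zero_iff two_ne_zero |>.1 (le_antisymm this (sq_nonneg _)))

lemma geo_zero (hZ : StewartSpace Z) (x y : Z) : hZ.geo x y 0 = x :=
  (hZ.eq_geo (by simp) (by simp) (by simp)).symm

lemma geo_one (hZ : StewartSpace Z) (x y : Z) : hZ.geo x y 1 = y :=
  (hZ.eq_geo (by simp) (by simp) (by simp)).symm

lemma map_geo {W : Type*} [MetricSpace W] (hZ : StewartSpace Z) (hW : StewartSpace W)
    {f : Z → W} (hf : Isometry f) (x y : Z) {t : ℝ} (ht : t ∈ Icc (0 : ℝ) 1) :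
    f (hZ.geo x y t) = hW.geo (f x) (f y) t :=
  hW.eq_geo ht (by rw [hf.dist_eq, hf.dist_eq]; exact hZ.dist_left_geo_le x y ht)
    (by rw [hf.dist_eq, hf.dist_eq]; exact hZ.dist_geo_right_le x y ht)

lemma one_sub_mem_Icc {t : ℝ} (ht : t ∈ Icc (0 : ℝ) 1) : 1 - t ∈ Icc (0 : ℝ) 1 :=
  ⟨by linarith [ht.2], by linarith [ht.1]⟩

lemma geo_symm (hZ : StewartSpace Z) (x y : Z) {t : ℝ} (ht : t ∈ Icc (0 : ℝ) 1) :
    hZ.geo x y t = hZ.geo y x (1 - t) :=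
  hZ.eq_geo (one_sub_mem_Icc ht)
    (by rw [dist_comm, dist_comm y x]; exact hZ.dist_geo_right_le x y ht)
    (by rw [dist_comm, dist_comm y x, sub_sub_cancel]; exact hZ.dist_left_geo_le x y ht)

lemma dist_geo_geo_le_abs (hZ : StewartSpace Z) (x y : Z) {s t : ℝ} (hs : s ∈ Icc (0 : ℝ) 1)
    (ht : t ∈ Icc (0 : ℝ) 1) :
    dist (hZ.geo x y s) (hZ.geo x y t) ≤ |s - t| * dist x y := by
  refine abs_le_of_sq_le_sq' ?_ (by positivity) |>.2
  refine (hZ.dist_sq_geo_le x y _ ht).trans (le_of_eq ?_)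
  rw [dist_comm _ x, hZ.dist_left_geo x y hs, hZ.dist_geo_right x y hs, mul_pow, mul_pow, mul_pow,
    sq_abs]
  ring

lemma dist_geo_geo_le_of_left (hZ : StewartSpace Z) (x y y' : Z) {t : ℝ}
    (ht : t ∈ Icc (0 : ℝ) 1) :
    dist (hZ.geo x y t) (hZ.geo x y' t) ≤ t * dist y y' := by
  refine abs_le_of_sq_le_sq' ?_ (mul_nonneg ht.1 dist_nonneg) |>.2
  have h₁ := hZ.dist_sq_geo_le x y' (hZ.geo x y t) ht
  have h₂ := mul_le_mul_of_nonneg_left (hZ.dist_sq_geo_le x y y' ht) ht.1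
  rw [dist_comm _ x, hZ.dist_left_geo x y ht] at h₁
  rw [dist_comm y' (hZ.geo x y t), dist_comm y' x, dist_comm y' y] at h₂
  refine h₁.trans ?_
  nlinarith

lemma dist_geo_geo_le_of_right (hZ : StewartSpace Z) (x x' y : Z) {t : ℝ}
    (ht : t ∈ Icc (0 : ℝ) 1) :
    dist (hZ.geo x y t) (hZ.geo x' y t) ≤ (1 - t) * dist x x' := by
  rw [hZ.geo_symm x y ht, hZ.geo_symm x' y ht]
  exact hZ.dist_geo_geo_le_of_left y x x' (one_sub_mem_Icc ht)

lemma dist_geo_geo_le (hZ : StewartSpace Z) (x y x' y' : Z) {t : ℝ} (ht : t ∈ Icc (0 : ℝ) 1) :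
    dist (hZ.geo x y t) (hZ.geo x' y' t) ≤ (1 - t) * dist x x' + t * dist y y' := by
  linarith [dist_triangle (hZ.geo x y t) (hZ.geo x y' t) (hZ.geo x' y' t),
    hZ.dist_geo_geo_le_of_left x y y' ht, hZ.dist_geo_geo_le_of_right x x' y' ht]

lemma half_mem_Icc : (1 / 2 : ℝ) ∈ Icc (0 : ℝ) 1 := by norm_num

lemma sq_add_sq_diagonals_le (hZ : StewartSpace Z) (p q r s : Z) :
    dist p r ^ 2 + dist q s ^ 2 ≤
      dist p q ^ 2 + dist q r ^ 2 + dist r s ^ 2 + dist s p ^ 2 := by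
  have h₁ := hZ.dist_sq_geo_le p r q half_mem_Icc
  have h₂ := hZ.dist_sq_geo_le p r s half_mem_Icc
  have h₃ := dist_triangle_right q s (hZ.geo p r (1 / 2))
  have h₄ : dist q s ^ 2 ≤ 2 * dist q (hZ.geo p r (1 / 2)) ^ 2 +
      2 * dist s (hZ.geo p r (1 / 2)) ^ 2 := by
    nlinarith [pow_le_pow_left₀ dist_nonneg h₃ 2,
      sq_nonneg (dist q (hZ.geo p r (1 / 2)) - dist s (hZ.geo p r (1 / 2)))]
  rw [dist_comm q p] at h₁
  rw [dist_comm s r] at h₂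
  linarith

/-- `f` moves `p` by `ℓ` and `f` does not bend the segment from `p` to `f p`. -/
def IsAxial (f : Z ≃ᵢ Z) (ℓ : ℝ) (p : Z) : Prop :=
  dist p (f p) = ℓ ∧ dist p (f (f p)) = 2 * ℓ

lemma IsAxial.map {f g : Z ≃ᵢ Z} {ℓ : ℝ} {p : Z} (hp : IsAxial f ℓ p) (h : Commute g f) :
    IsAxial f ℓ (g p) := by
  have h' : ∀ x, f (g x) = g (f x) := fun x ↦ (DFunLike.congr_fun h.eq x).symm
  exact ⟨by rw [h', g.isometry.dist_eq, hp.1], by rw [h', h', g.isometry.dist_eq, hp.2]⟩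

lemma isAxial_of_forall_le (hZ : StewartSpace Z) {f : Z ≃ᵢ Z} {p : Z}
    (h : ∀ x, dist p (f p) ≤ dist x (f x)) : IsAxial f (dist p (f p)) p := by
  refine ⟨rfl, le_antisymm ?_ ?_⟩
  · have := dist_triangle p (f p) (f (f p))
    rw [f.isometry.dist_eq] at this
    linarith
  · have h₁ := h (hZ.geo p (f p) (1 / 2))
    have h₂ := hZ.dist_geo_geo_le_of_left (f p) p (f (f p)) half_mem_Icc
    rw [hZ.map_geo hZ f.isometry _ _ half_mem_Icc, hZ.geo_symm p (f p) half_mem_Icc] at h₁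
    norm_num at h₁ h₂
    linarith

lemma IsAxial.dist_pow (hZ : StewartSpace Z) {f : Z ≃ᵢ Z} {ℓ : ℝ} {p : Z} (hp : IsAxial f ℓ p)
    (n : ℕ) : dist p ((f ^ n) p) = n * ℓ := by
  have hℓ : 0 ≤ ℓ := hp.1 ▸ dist_nonneg
  suffices h : dist p ((f ^ n) p) = n * ℓ ∧ dist p ((f ^ (n + 1)) p) = (n + 1 : ℕ) * ℓ from h.1
  induction n with
  | zero => simpa using hp.1
  | succ n ih =>
    refine ⟨ih.2, ?_⟩
    have e₁ : (f ^ (n + 1)) p = (f ^ n) (f p) := by rw [pow_succ]; rfl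
    have e₂ : (f ^ (n + 1 + 1)) p = (f ^ n) (f (f p)) := by rw [pow_succ, pow_succ]; rfl
    have d₁ : dist ((f ^ n) p) ((f ^ (n + 1)) p) = ℓ := by
      rw [e₁, (f ^ n).isometry.dist_eq, hp.1]
    have d₂ : dist ((f ^ (n + 1)) p) ((f ^ (n + 1 + 1)) p) = ℓ := by
      rw [e₁, e₂, (f ^ n).isometry.dist_eq, f.isometry.dist_eq, hp.1]
    have d₃ : dist ((f ^ n) p) ((f ^ (n + 1 + 1)) p) = 2 * ℓ := by
      rw [e₂, (f ^ n).isometry.dist_eq, hp.2]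
    have hmid : (f ^ (n + 1)) p = hZ.geo ((f ^ n) p) ((f ^ (n + 1 + 1)) p) (1 / 2) :=
      hZ.eq_geo half_mem_Icc (by linarith) (by linarith)
    have h := hZ.dist_sq_geo_le ((f ^ n) p) ((f ^ (n + 1 + 1)) p) p half_mem_Icc
    rw [← hmid, ih.1, ih.2, d₃] at h
    have hup := dist_triangle p ((f ^ (n + 1)) p) ((f ^ (n + 1 + 1)) p)
    rw [ih.2, d₂] at hup
    push_cast at h hup ⊢
    refine le_antisymm (by linarith) ?_
    refine abs_le_of_sq_le_sq' ?_ dist_nonneg |>.2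
    nlinarith

lemma IsAxial.dist_zpow (hZ : StewartSpace Z) {f : Z ≃ᵢ Z} {ℓ : ℝ} {p : Z} (hp : IsAxial f ℓ p)
    (m n : ℤ) : dist ((f ^ m) p) ((f ^ n) p) = |(m : ℝ) - n| * ℓ := by
  wlog hmn : m ≤ n generalizing m n
  · rw [dist_comm, this n m (by omega), abs_sub_comm]
  obtain ⟨k, rfl⟩ := Int.le.dest hmn
  have e : (f ^ (m + k : ℤ)) p = (f ^ m) ((f ^ k) p) := by rw [zpow_add, zpow_natCast]; rfl
  rw [e, (f ^ m).isometry.dist_eq, hp.dist_pow hZ]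
  push_cast
  rw [sub_add_cancel_left, abs_neg, Nat.abs_cast]

/-- A point moved along an axis is moved by the least possible amount. -/
lemma IsAxial.le_dist (hZ : StewartSpace Z) {f : Z ≃ᵢ Z} {ℓ : ℝ} {p : Z} (hp : IsAxial f ℓ p)
    (x : Z) : ℓ ≤ dist x (f x) := by
  have h : ∀ n : ℕ, dist x ((f ^ n) x) ≤ n * dist x (f x) := by
    intro n
    induction n with
    | zero => simp
    | succ n ih =>
      have e : (f ^ (n + 1)) x = (f ^ n) (f x) := by rw [pow_succ]; rfl
      have := dist_triangle x ((f ^ n) x) ((f ^ (n + 1)) x)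
      rw [e, (f ^ n).isometry.dist_eq] at this
      rw [e]
      push_cast
      linarith
  by_contra! hlt
  obtain ⟨n, hn⟩ := exists_nat_gt (2 * dist p x / (ℓ - dist x (f x)))
  rw [div_lt_iff₀ (by linarith)] at hn
  have h₁ := dist_triangle4 p x ((f ^ n) x) ((f ^ n) p)
  rw [hp.dist_pow hZ, (f ^ n).isometry.dist_eq, dist_comm x p] at h₁
  linarith [h n]

lemma IsAxial.transLen_eq (hZ : StewartSpace Z) {f : Z ≃ᵢ Z} {ℓ : ℝ} {p : Z}
    (hp : IsAxial f ℓ p) : transLen f = ℓ :=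
  IsLeast.csInf_eq ⟨⟨p, hp.1⟩, by rintro _ ⟨x, rfl⟩; exact hp.le_dist hZ x⟩

lemma isAxial_iff_mem_minSet (hZ : StewartSpace Z) {f : Z ≃ᵢ Z} {p : Z} :
    IsAxial f (transLen f) p ↔ p ∈ MinSet f := by
  refine ⟨fun h ↦ h.1, fun h ↦ ?_⟩
  have h' : dist p (f p) = transLen f := h
  rw [← h']
  refine hZ.isAxial_of_forall_le fun x ↦ ?_
  rw [h']
  exact csInf_le ⟨0, by rintro _ ⟨x, rfl⟩; exact dist_nonneg⟩ ⟨x, rfl⟩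

/-- The line through the orbit of `p` under the powers of `f`, parametrized so that `f` moves
it by `ℓ`. -/
noncomputable def axis (hZ : StewartSpace Z) (f : Z ≃ᵢ Z) (ℓ : ℝ) (p : Z) (t : ℝ) : Z :=
  hZ.geo ((f ^ ⌊t / ℓ⌋) p) ((f ^ (⌊t / ℓ⌋ + 1)) p) (Int.fract (t / ℓ))

lemma fract_mem_Icc (x : ℝ) : Int.fract x ∈ Icc (0 : ℝ) 1 :=
  ⟨Int.fract_nonneg x, (Int.fract_lt_one x).le⟩

lemma axis_zero (hZ : StewartSpace Z) (f : Z ≃ᵢ Z) (ℓ : ℝ) (p : Z) : hZ.axis f ℓ p 0 = p := by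
  simp [axis, geo_zero]

lemma map_axis (hZ : StewartSpace Z) {f g : Z ≃ᵢ Z} (h : Commute g f) (ℓ : ℝ) (p : Z) (t : ℝ) :
    g (hZ.axis f ℓ p t) = hZ.axis f ℓ (g p) t := by
  have h' : ∀ k : ℤ, g ((f ^ k) p) = (f ^ k) (g p) := fun k ↦
    DFunLike.congr_fun (h.zpow_right k).eq p
  rw [axis, hZ.map_geo hZ g.isometry _ _ (fract_mem_Icc _), h', h', axis]

lemma map_axis_self (hZ : StewartSpace Z) (f : Z ≃ᵢ Z) {ℓ : ℝ} (hℓ : 0 < ℓ) (p : Z) (t : ℝ) :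
    f (hZ.axis f ℓ p t) = hZ.axis f ℓ p (t + ℓ) := by
  have h : (t + ℓ) / ℓ = t / ℓ + 1 := by field_simp
  have h' : ∀ k : ℤ, f ((f ^ k) p) = (f ^ (k + 1)) p := fun k ↦ by
    rw [add_comm, zpow_add, zpow_one]; rfl
  rw [axis, axis, h, Int.floor_add_one, Int.fract_add_one,
    hZ.map_geo hZ f.isometry _ _ (fract_mem_Icc _), h', h']

lemma zpow_map_axis (hZ : StewartSpace Z) (f : Z ≃ᵢ Z) {ℓ : ℝ} (hℓ : 0 < ℓ) (p : Z) (t : ℝ)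
    (k : ℤ) : (f ^ k) (hZ.axis f ℓ p t) = hZ.axis f ℓ p (t + k * ℓ) := by
  induction k with
  | zero => simp
  | succ n ih =>
    have : (f ^ ((n : ℤ) + 1)) (hZ.axis f ℓ p t) = f ((f ^ (n : ℤ)) (hZ.axis f ℓ p t)) := by
      rw [add_comm, zpow_add, zpow_one]; rfl
    rw [this, ih, hZ.map_axis_self f hℓ]
    push_cast
    ring_nf
  | pred n ih =>
    apply f.injective
    have : f ((f ^ (-(n : ℤ) - 1)) (hZ.axis f ℓ p t)) = (f ^ (-(n : ℤ))) (hZ.axis f ℓ p t) := by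
      have : (-(n : ℤ)) = 1 + (-(n : ℤ) - 1) := by ring
      conv_rhs => rw [this, zpow_add, zpow_one]
      rfl
    rw [this, ih, hZ.map_axis_self f hℓ]
    push_cast
    ring_nf

lemma IsAxial.dist_zpow_axis (hZ : StewartSpace Z) {f : Z ≃ᵢ Z} {ℓ : ℝ} (hℓ : 0 < ℓ) {p : Z}
    (hp : IsAxial f ℓ p) (t : ℝ) :
    dist ((f ^ ⌊t / ℓ⌋) p) (hZ.axis f ℓ p t) = t - ⌊t / ℓ⌋ * ℓ := by
  rw [axis, hZ.dist_left_geo _ _ (fract_mem_Icc _), hp.dist_zpow hZ, Int.fract]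
  push_cast
  rw [sub_add_cancel_left, abs_neg, abs_one]
  field_simp

lemma IsAxial.dist_axis_zpow (hZ : StewartSpace Z) {f : Z ≃ᵢ Z} {ℓ : ℝ} (hℓ : 0 < ℓ) {p : Z}
    (hp : IsAxial f ℓ p) (t : ℝ) :
    dist (hZ.axis f ℓ p t) ((f ^ (⌊t / ℓ⌋ + 1)) p) = (⌊t / ℓ⌋ + 1) * ℓ - t := by
  rw [axis, hZ.dist_geo_right _ _ (fract_mem_Icc _), hp.dist_zpow hZ, Int.fract]
  push_cast
  rw [sub_add_cancel_left, abs_neg, abs_one]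
  field_simp
  ring

lemma IsAxial.dist_axis (hZ : StewartSpace Z) {f : Z ≃ᵢ Z} {ℓ : ℝ} (hℓ : 0 < ℓ) {p : Z}
    (hp : IsAxial f ℓ p) (s t : ℝ) :
    dist (hZ.axis f ℓ p s) (hZ.axis f ℓ p t) = |s - t| := by
  wlog hst : s ≤ t generalizing s t
  · rw [dist_comm, this t s (by linarith), abs_sub_comm]
  rw [abs_sub_comm, abs_of_nonneg (sub_nonneg.2 hst)]
  have hmn : ⌊s / ℓ⌋ ≤ ⌊t / ℓ⌋ := Int.floor_mono (by gcongr)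
  have hmn' : (⌊s / ℓ⌋ : ℝ) ≤ ⌊t / ℓ⌋ := by exact_mod_cast hmn
  apply le_antisymm
  · rcases hmn.eq_or_lt with h | h
    · have h₁ := hZ.dist_geo_geo_le_abs ((f ^ ⌊t / ℓ⌋) p) ((f ^ (⌊t / ℓ⌋ + 1)) p)
        (fract_mem_Icc (s / ℓ)) (fract_mem_Icc (t / ℓ))
      rw [hp.dist_zpow hZ] at h₁
      have h₂ : |Int.fract (s / ℓ) - Int.fract (t / ℓ)| = (t - s) / ℓ := by
        rw [Int.fract, Int.fract, h, sub_sub_sub_cancel_right, ← sub_div, abs_div,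
          abs_of_pos hℓ, abs_sub_comm, abs_of_nonneg (sub_nonneg.2 hst)]
      rw [h₂] at h₁
      push_cast at h₁
      rw [sub_add_cancel_left, abs_neg, abs_one, one_mul, div_mul_cancel₀ _ hℓ.ne'] at h₁
      rw [axis, axis, h]
      exact h₁
    · have h₁ := dist_triangle4 (hZ.axis f ℓ p s) ((f ^ (⌊s / ℓ⌋ + 1)) p) ((f ^ ⌊t / ℓ⌋) p)
        (hZ.axis f ℓ p t)
      have h' : (⌊s / ℓ⌋ : ℝ) + 1 ≤ ⌊t / ℓ⌋ := by exact_mod_cast h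
      rw [hp.dist_axis_zpow hZ hℓ, hp.dist_zpow_axis hZ hℓ, hp.dist_zpow hZ, abs_sub_comm,
        abs_of_nonneg (by push_cast; linarith)] at h₁
      push_cast at h₁
      linarith
  · have h₁ := dist_triangle4 ((f ^ ⌊s / ℓ⌋) p) (hZ.axis f ℓ p s) (hZ.axis f ℓ p t)
      ((f ^ (⌊t / ℓ⌋ + 1)) p)
    rw [hp.dist_axis_zpow hZ hℓ, hp.dist_zpow_axis hZ hℓ, hp.dist_zpow hZ, abs_sub_comm,
      abs_of_nonneg (by push_cast; linarith)] at h₁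
    push_cast at h₁
    linarith

lemma IsAxial.axis_mem (hZ : StewartSpace Z) {f : Z ≃ᵢ Z} {ℓ : ℝ} (hℓ : 0 < ℓ) {p : Z}
    (hp : IsAxial f ℓ p) (t : ℝ) : IsAxial f ℓ (hZ.axis f ℓ p t) := by
  constructor
  · rw [hZ.map_axis_self f hℓ, hp.dist_axis hZ hℓ, sub_add_cancel_left, abs_neg, abs_of_pos hℓ]
  · rw [hZ.map_axis_self f hℓ, hZ.map_axis_self f hℓ, hp.dist_axis hZ hℓ, add_assoc,
      sub_add_cancel_left, abs_neg, abs_of_pos (by linarith), two_mul]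

lemma IsAxial.axis_axis (hZ : StewartSpace Z) {f : Z ≃ᵢ Z} {ℓ : ℝ} (hℓ : 0 < ℓ) {p : Z}
    (hp : IsAxial f ℓ p) (s t : ℝ) :
    hZ.axis f ℓ (hZ.axis f ℓ p s) t = hZ.axis f ℓ p (s + t) := by
  have h₁ := Int.fract_nonneg (t / ℓ)
  have h₂ := (Int.fract_lt_one (t / ℓ)).le
  have h₃ : t = ⌊t / ℓ⌋ * ℓ + Int.fract (t / ℓ) * ℓ := by
    rw [← add_mul, Int.floor_add_fract, div_mul_cancel₀ _ hℓ.ne']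
  conv_lhs => rw [axis]
  symm
  apply hZ.eq_geo ⟨h₁, h₂⟩
  all_goals
    rw [hZ.zpow_map_axis f hℓ, hZ.zpow_map_axis f hℓ, hp.dist_axis hZ hℓ, hp.dist_axis hZ hℓ]
    push_cast
  · rw [show s + ⌊t / ℓ⌋ * ℓ - (s + t) = -(Int.fract (t / ℓ) * ℓ) by linarith,
      show s + ⌊t / ℓ⌋ * ℓ - (s + (⌊t / ℓ⌋ + 1) * ℓ) = -ℓ by ring, abs_neg, abs_neg,
      abs_of_pos hℓ, abs_of_nonneg (by positivity)]
  · rw [show s + t - (s + (⌊t / ℓ⌋ + 1) * ℓ) = -((1 - Int.fract (t / ℓ)) * ℓ) by linarith,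
      show s + ⌊t / ℓ⌋ * ℓ - (s + (⌊t / ℓ⌋ + 1) * ℓ) = -ℓ by ring, abs_neg, abs_neg,
      abs_of_pos hℓ, abs_of_nonneg (mul_nonneg (by linarith) hℓ.le)]

lemma IsAxial.axis_eq_geo (hZ : StewartSpace Z) {f : Z ≃ᵢ Z} {ℓ : ℝ} (hℓ : 0 < ℓ) {p : Z}
    (hp : IsAxial f ℓ p) (s t : ℝ) {r : ℝ} (hr : r ∈ Icc (0 : ℝ) 1) :
    hZ.axis f ℓ p ((1 - r) * s + r * t) = hZ.geo (hZ.axis f ℓ p s) (hZ.axis f ℓ p t) r := by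
  apply hZ.eq_geo hr <;> rw [hp.dist_axis hZ hℓ, hp.dist_axis hZ hℓ]
  · rw [show s - ((1 - r) * s + r * t) = r * (s - t) by ring, abs_mul, abs_of_nonneg hr.1]
  · rw [show (1 - r) * s + r * t - t = (1 - r) * (s - t) by ring, abs_mul,
      abs_of_nonneg (sub_nonneg.2 hr.2)]

end StewartSpace

/-- A continuous solution of the parallelogram form of Jensen's equation is affine. -/
lemma eq_add_mul_of_jensen {E : ℝ → ℝ} (hc : Continuous E)
    (h : ∀ s t, E (s + t) + E (s - t) = 2 * E s) (s : ℝ) : E s = E 0 + s * (E 1 - E 0) := by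
  let G : ℝ →+ ℝ :=
    { toFun := fun s ↦ E s - E 0
      map_zero' := sub_self _
      map_add' := fun u v ↦ by
        have h₁ := h ((u + v) / 2) ((u - v) / 2)
        have h₂ := h ((u + v) / 2) ((u + v) / 2)
        rw [show (u + v) / 2 + (u - v) / 2 = u by ring,
          show (u + v) / 2 - (u - v) / 2 = v by ring] at h₁
        rw [add_halves, sub_self] at h₂
        linarith }
  have hG : Continuous G := hc.sub continuous_const
  have := map_real_smul G hG s 1
  simp only [smul_eq_mul, mul_one] at this
  have h₁ : G s = E s - E 0 := rfl
  have h₂ : G 1 = E 1 - E 0 := rfl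
  rw [h₁, h₂] at this
  linarith

namespace StewartSpace

variable {Z : Type*} [MetricSpace Z]

lemma IsAxial.dist_axis_add_le (hZ : StewartSpace Z) {f : Z ≃ᵢ Z} {ℓ : ℝ} (hℓ : 0 < ℓ) {p q : Z}
    (hp : IsAxial f ℓ p) (hq : IsAxial f ℓ q) (s t t₀ : ℝ) :
    dist (hZ.axis f ℓ p t) (hZ.axis f ℓ q (t + s)) ≤
      dist (hZ.axis f ℓ p t₀) (hZ.axis f ℓ q (t₀ + s)) := by
  set k := ⌊(t - t₀) / ℓ⌋
  set r := Int.fract ((t - t₀) / ℓ)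
  have hr : r ∈ Icc (0 : ℝ) 1 := fract_mem_Icc _
  have h : t = t₀ + (k * ℓ + r * ℓ) := by
    rw [← add_mul, Int.floor_add_fract, div_mul_cancel₀ _ hℓ.ne']; ring
  have hk : ∀ k : ℤ, dist (hZ.axis f ℓ p (t₀ + k * ℓ)) (hZ.axis f ℓ q (t₀ + s + k * ℓ)) =
      dist (hZ.axis f ℓ p t₀) (hZ.axis f ℓ q (t₀ + s)) := fun k ↦ by
    rw [← hZ.zpow_map_axis f hℓ, ← hZ.zpow_map_axis f hℓ, (f ^ k).isometry.dist_eq]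
  have h₁ : t = (1 - r) * (t₀ + k * ℓ) + r * (t₀ + (k + 1 : ℤ) * ℓ) := by
    push_cast; linarith
  have h₂ : t + s = (1 - r) * (t₀ + s + k * ℓ) + r * (t₀ + s + (k + 1 : ℤ) * ℓ) := by
    push_cast; linarith
  rw [h₂, h₁, hp.axis_eq_geo hZ hℓ _ _ hr, hq.axis_eq_geo hZ hℓ _ _ hr]
  refine (hZ.dist_geo_geo_le _ _ _ _ hr).trans (le_of_eq ?_)
  rw [hk, hk]
  ring

lemma IsAxial.dist_axis_axis (hZ : StewartSpace Z) {f : Z ≃ᵢ Z} {ℓ : ℝ} (hℓ : 0 < ℓ) {p q : Z}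
    (hp : IsAxial f ℓ p) (hq : IsAxial f ℓ q) (s t : ℝ) :
    dist (hZ.axis f ℓ p s) (hZ.axis f ℓ q t) = dist p (hZ.axis f ℓ q (t - s)) := by
  have h₁ := hp.dist_axis_add_le hZ hℓ hq (t - s) s 0
  have h₂ := hp.dist_axis_add_le hZ hℓ hq (t - s) 0 s
  rw [hZ.axis_zero, zero_add, add_sub_cancel] at h₁ h₂
  exact le_antisymm h₁ h₂

/-- Two parallel axes bound a flat strip. -/
lemma IsAxial.exists_dist_sq_eq (hZ : StewartSpace Z) {f : Z ≃ᵢ Z} {ℓ : ℝ} (hℓ : 0 < ℓ) {p q : Z}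
    (hp : IsAxial f ℓ p) (hq : IsAxial f ℓ q) :
    ∃ τ ω : ℝ, 0 ≤ ω ∧ ∀ s t,
      dist (hZ.axis f ℓ p s) (hZ.axis f ℓ q t) ^ 2 = (s - t + τ) ^ 2 + ω := by
  set D : ℝ → ℝ := fun t ↦ dist p (hZ.axis f ℓ q t) with hD
  have hD' : ∀ s t, dist (hZ.axis f ℓ p s) (hZ.axis f ℓ q t) = D (t - s) :=
    hp.dist_axis_axis hZ hℓ hq
  have hq_isom : Isometry (hZ.axis f ℓ q) := Isometry.of_dist_eq fun s t ↦ by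
    rw [hq.dist_axis hZ hℓ, Real.dist_eq]
  have hDc : Continuous D := continuous_const.dist hq_isom.continuous
  have hJ : ∀ s t, (D (s + t) ^ 2 - (s + t) ^ 2) + (D (s - t) ^ 2 - (s - t) ^ 2) =
      2 * (D s ^ 2 - s ^ 2) := by
    intro s t
    have h₁ := hZ.sq_add_sq_diagonals_le (hZ.axis f ℓ p 0) (hZ.axis f ℓ p t)
      (hZ.axis f ℓ q (s + t)) (hZ.axis f ℓ q s)
    rw [hp.dist_axis hZ hℓ, hq.dist_axis hZ hℓ, hD', hD', hD', sq_abs, sq_abs,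
      dist_comm _ (hZ.axis f ℓ p 0), hD', add_sub_cancel_right, sub_zero, sub_zero] at h₁
    have h₂ := hZ.dist_sq_geo_le (hZ.axis f ℓ q (s - t)) (hZ.axis f ℓ q (s + t)) p half_mem_Icc
    rw [← hq.axis_eq_geo hZ hℓ _ _ half_mem_Icc, hq.dist_axis hZ hℓ, sq_abs,
      show (1 - 1 / 2) * (s - t) + 1 / 2 * (s + t) = s by ring] at h₂
    change D s ^ 2 ≤ (1 - 1 / 2) * D (s - t) ^ 2 + 1 / 2 * D (s + t) ^ 2 - _ at h₂
    nlinarith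
  have hE := eq_add_mul_of_jensen (E := fun s ↦ D s ^ 2 - s ^ 2) (by fun_prop) hJ
  set β := (D 1 ^ 2 - 1 ^ 2) - (D 0 ^ 2 - 0 ^ 2)
  have hE' : ∀ s, D s ^ 2 = (s + β / 2) ^ 2 + (D 0 ^ 2 - β ^ 2 / 4) := fun s ↦ by
    have := hE s
    linear_combination this
  refine ⟨-(β / 2), D 0 ^ 2 - β ^ 2 / 4, ?_, fun s t ↦ ?_⟩
  · have := hE' (-(β / 2))
    nlinarith [sq_nonneg (D (-(β / 2)))]
  · rw [hD', hE']
    ring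

end StewartSpace

/-- The shift between parallel lines is subadditive. -/
lemma shift_le_add {Z : Type*} [MetricSpace Z] {c₁ c₂ c₃ : ℝ → Z} {τ₁₂ τ₂₃ τ₁₃ ω₁₂ ω₂₃ ω₁₃ : ℝ}
    (h₁₂' : 0 ≤ ω₁₂) (h₂₃' : 0 ≤ ω₂₃) (h₁₃' : 0 ≤ ω₁₃)
    (h₁₂ : ∀ s t, dist (c₁ s) (c₂ t) ^ 2 = (s - t + τ₁₂) ^ 2 + ω₁₂)
    (h₂₃ : ∀ s t, dist (c₂ s) (c₃ t) ^ 2 = (s - t + τ₂₃) ^ 2 + ω₂₃)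
    (h₁₃ : ∀ s t, dist (c₁ s) (c₃ t) ^ 2 = (s - t + τ₁₃) ^ 2 + ω₁₃) :
    τ₁₃ ≤ τ₁₂ + τ₂₃ := by
  by_contra! hlt
  set ε := τ₁₃ - (τ₁₂ + τ₂₃) with hε
  have hε0 : 0 < ε := by linarith
  have key : ∀ {u ω d : ℝ}, 0 ≤ ω → 1 + 2 * ω / ε ≤ u → d ^ 2 = u ^ 2 + ω → d ≤ u + ε / 4 := by
    intro u ω d hω hu hd
    have h₀ : 0 ≤ 2 * ω / ε := by positivity
    have h₁ : 2 * ω / ε ≤ u := by linarith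
    rw [div_le_iff₀ hε0] at h₁
    refine abs_le_of_sq_le_sq' ?_ (by linarith) |>.2
    nlinarith
  set T := |τ₁₂| + |τ₂₃| + 1 + 2 * (ω₁₂ + ω₂₃) / ε with hT
  have hsplit : 2 * (ω₁₂ + ω₂₃) / ε = 2 * ω₁₂ / ε + 2 * ω₂₃ / ε := by ring
  have p₁ : 0 ≤ 2 * ω₁₂ / ε := by positivity
  have p₂ : 0 ≤ 2 * ω₂₃ / ε := by positivity
  have a₁ := neg_abs_le τ₁₂
  have a₂ := neg_abs_le τ₂₃
  have b₁ := abs_nonneg τ₁₂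
  have b₂ := abs_nonneg τ₂₃
  have k₁ := key h₁₂' (u := 2 * T - T + τ₁₂) (by linarith) (h₁₂ (2 * T) T)
  have k₂ := key h₂₃' (u := T - 0 + τ₂₃) (by linarith) (h₂₃ T 0)
  have k₃ : 2 * T - 0 + τ₁₃ ≤ dist (c₁ (2 * T)) (c₃ 0) :=
    abs_le_of_sq_le_sq' (by rw [h₁₃]; linarith) dist_nonneg |>.2
  linarith [dist_triangle (c₁ (2 * T)) (c₂ T) (c₃ 0)]

namespace StewartSpace

variable {Z : Type*} [MetricSpace Z]

/-- The coordinate of `x` along the line parallel to the axis of `f` through `x₀`, measured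
from the level of `x₀`. -/
noncomputable def height (hZ : StewartSpace Z) (f : Z ≃ᵢ Z) (ℓ : ℝ) (x₀ x : Z) : ℝ :=
  (dist x x₀ ^ 2 + 1 - dist x (hZ.axis f ℓ x₀ 1) ^ 2) / 2

lemma IsAxial.exists_dist_sq_eq_height (hZ : StewartSpace Z) {f : Z ≃ᵢ Z} {ℓ : ℝ} (hℓ : 0 < ℓ)
    {x₀ x y : Z} (h₀ : IsAxial f ℓ x₀) (hx : IsAxial f ℓ x) (hy : IsAxial f ℓ y) :
    ∃ ω : ℝ, 0 ≤ ω ∧ ∀ s t, dist (hZ.axis f ℓ x s) (hZ.axis f ℓ y t) ^ 2 =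
      (s - t + (hZ.height f ℓ x₀ x - hZ.height f ℓ x₀ y)) ^ 2 + ω := by
  have hh : ∀ {z : Z} {τ ω : ℝ}, (∀ s t, dist (hZ.axis f ℓ z s) (hZ.axis f ℓ x₀ t) ^ 2 =
      (s - t + τ) ^ 2 + ω) → hZ.height f ℓ x₀ z = τ := by
    intro z τ ω h
    have h₁ := h 0 0
    have h₂ := h 0 1
    rw [hZ.axis_zero] at h₁ h₂
    rw [hZ.axis_zero] at h₁
    rw [height, h₁, h₂]
    ring
  obtain ⟨τ₁, ω₁, hω₁, h₁⟩ := hx.exists_dist_sq_eq hZ hℓ hy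
  obtain ⟨τ₂, ω₂, hω₂, h₂⟩ := hy.exists_dist_sq_eq hZ hℓ h₀
  obtain ⟨τ₃, ω₃, hω₃, h₃⟩ := hx.exists_dist_sq_eq hZ hℓ h₀
  have h₁' : ∀ s t, dist (hZ.axis f ℓ y s) (hZ.axis f ℓ x t) ^ 2 =
      (s - t + -τ₁) ^ 2 + ω₁ := fun s t ↦ by rw [dist_comm, h₁]; ring
  have l₁ := shift_le_add hω₁ hω₂ hω₃ h₁ h₂ h₃
  have l₂ := shift_le_add hω₁ hω₃ hω₂ h₁' h₃ h₂
  refine ⟨ω₁, hω₁, fun s t ↦ ?_⟩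
  rw [hh h₂, hh h₃, h₁, show τ₁ = τ₃ - τ₂ by linarith]

lemma height_self (hZ : StewartSpace Z) {f : Z ≃ᵢ Z} {ℓ : ℝ} (hℓ : 0 < ℓ) {x₀ : Z}
    (h₀ : IsAxial f ℓ x₀) : hZ.height f ℓ x₀ x₀ = 0 := by
  have h := h₀.dist_axis hZ hℓ 0 1
  rw [hZ.axis_zero] at h
  rw [height, h]
  norm_num

lemma IsAxial.height_axis (hZ : StewartSpace Z) {f : Z ≃ᵢ Z} {ℓ : ℝ} (hℓ : 0 < ℓ)
    {x₀ x : Z} (h₀ : IsAxial f ℓ x₀) (hx : IsAxial f ℓ x) (t : ℝ) :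
    hZ.height f ℓ x₀ (hZ.axis f ℓ x t) = hZ.height f ℓ x₀ x + t := by
  obtain ⟨ω, -, h⟩ := h₀.exists_dist_sq_eq_height hZ hℓ hx h₀
  have h₁ := h t 0
  have h₂ := h t 1
  rw [hZ.axis_zero] at h₁
  rw [height, h₁, h₂, hZ.height_self hℓ h₀]
  ring

/-- The height is an affine function along the segments joining points of the axes. -/
lemma IsAxial.height_geo (hZ : StewartSpace Z) {f : Z ≃ᵢ Z} {ℓ : ℝ} (hℓ : 0 < ℓ)
    {x₀ x y : Z} (h₀ : IsAxial f ℓ x₀) (hx : IsAxial f ℓ x) (hy : IsAxial f ℓ y)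
    (hx₀ : hZ.height f ℓ x₀ x = 0) (hy₀ : hZ.height f ℓ x₀ y = 0) {t : ℝ}
    (ht : t ∈ Icc (0 : ℝ) 1) (hu : IsAxial f ℓ (hZ.geo x y t)) :
    hZ.height f ℓ x₀ (hZ.geo x y t) = 0 := by
  set u := hZ.geo x y t with hu_def
  set η := hZ.height f ℓ x₀ u with hη
  by_contra hne
  have key : ∀ {z : Z}, IsAxial f ℓ z → hZ.height f ℓ x₀ z = 0 →
      dist z (hZ.axis f ℓ u (-η)) < dist z u := by
    intro z hz hz₀
    obtain ⟨ω, -, h⟩ := h₀.exists_dist_sq_eq_height hZ hℓ hz hu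
    have h₁ := h 0 0
    have h₂ := h 0 (-η)
    rw [hZ.axis_zero, hz₀] at h₁ h₂
    rw [hZ.axis_zero] at h₁
    rw [← hη] at h₁ h₂
    refine lt_of_pow_lt_pow_left₀ 2 dist_nonneg ?_
    have : 0 < η ^ 2 := by positivity
    nlinarith
  have k₁ := key hx hx₀
  have k₂ := key hy hy₀
  have e₁ := hZ.dist_left_geo x y ht
  have e₂ := hZ.dist_geo_right x y ht
  rw [← hu_def] at e₁ e₂
  have := dist_triangle_right x y (hZ.axis f ℓ u (-η))
  rw [dist_comm] at e₂
  linarith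

lemma IsAxial.geo_mem (hZ : StewartSpace Z) {f : Z ≃ᵢ Z} {ℓ : ℝ} {x y : Z}
    (hx : IsAxial f ℓ x) (hy : IsAxial f ℓ y) {t : ℝ} (ht : t ∈ Icc (0 : ℝ) 1) :
    IsAxial f ℓ (hZ.geo x y t) := by
  have h : dist (hZ.geo x y t) (f (hZ.geo x y t)) ≤ ℓ := by
    rw [hZ.map_geo hZ f.isometry _ _ ht]
    have := hZ.dist_geo_geo_le x y (f x) (f y) ht
    rw [hx.1, hy.1] at this
    linarith
  have h' := le_antisymm h (hx.le_dist hZ _)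
  have := hZ.isAxial_of_forall_le (f := f) (p := hZ.geo x y t)
    fun z ↦ h.trans (hx.le_dist hZ z)
  rwa [h'] at this

/-- The set of points moved by `ℓ` by an isometry `f` of minimal displacement `ℓ > 0` is a
product with a line, along which `f` is a translation, and every isometry commuting with `f`
respects the product decomposition. -/
theorem exists_product_decomposition (hZ : StewartSpace Z) {f : Z ≃ᵢ Z} {ℓ : ℝ} (hℓ : 0 < ℓ)
    {x₀ : Z} (h₀ : IsAxial f ℓ x₀) :
    ∃ (Y : Set Z) (E : Y → ℝ → Z), Y.Nonempty ∧ StewartSpace Y ∧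
      (∀ y y' s t, dist (E y s) (E y' t) ^ 2 = dist y y' ^ 2 + (s - t) ^ 2) ∧
      (∀ y t, f (E y t) = E y (t + ℓ)) ∧
      (∀ x, IsAxial f ℓ x → ∃ y t, E y t = x) ∧
      ∀ g : Z ≃ᵢ Z, Commute g f → ∃ (g' : Y ≃ᵢ Y) (β : ℝ), ∀ y t, g (E y t) = E (g' y) (t + β) := by
  let Y : Set Z := {y | IsAxial f ℓ y ∧ hZ.height f ℓ x₀ y = 0}
  let E : Y → ℝ → Z := fun y t ↦ hZ.axis f ℓ y t
  have hE : ∀ y y' s t, dist (E y s) (E y' t) ^ 2 = dist y y' ^ 2 + (s - t) ^ 2 := by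
    rintro ⟨y, hy, hy₀⟩ ⟨y', hy', hy₀'⟩ s t
    obtain ⟨ω, -, h⟩ := h₀.exists_dist_sq_eq_height hZ hℓ hy hy'
    rw [hy₀, hy₀'] at h
    have h₁ := h 0 0
    rw [hZ.axis_zero, hZ.axis_zero] at h₁
    change dist (hZ.axis f ℓ y s) (hZ.axis f ℓ y' t) ^ 2 = dist y y' ^ 2 + _
    rw [h, h₁]
    ring
  have hsurj : ∀ x, IsAxial f ℓ x → ∃ y t, E y t = x := fun x hx ↦ by
    refine ⟨⟨hZ.axis f ℓ x (-hZ.height f ℓ x₀ x), hx.axis_mem hZ hℓ _, ?_⟩,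
      hZ.height f ℓ x₀ x, ?_⟩
    · rw [h₀.height_axis hZ hℓ hx, add_neg_cancel]
    · change hZ.axis f ℓ (hZ.axis f ℓ x _) _ = x
      rw [hx.axis_axis hZ hℓ, neg_add_cancel, hZ.axis_zero]
  have hshift : ∀ g : Z ≃ᵢ Z, Commute g f → ∀ x, IsAxial f ℓ x →
      hZ.height f ℓ x₀ (g x) = hZ.height f ℓ x₀ x + hZ.height f ℓ x₀ (g x₀) := by
    intro g hg x hx
    obtain ⟨ω, -, h⟩ := h₀.exists_dist_sq_eq_height hZ hℓ hx h₀
    obtain ⟨ω', -, h'⟩ := h₀.exists_dist_sq_eq_height hZ hℓ (hx.map hg) (h₀.map hg)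
    have key : ∀ t, (0 - t + (hZ.height f ℓ x₀ x - hZ.height f ℓ x₀ x₀)) ^ 2 + ω =
        (0 - t + (hZ.height f ℓ x₀ (g x) - hZ.height f ℓ x₀ (g x₀))) ^ 2 + ω' := fun t ↦ by
      rw [← h, ← h', ← hZ.map_axis hg, ← hZ.map_axis hg, g.isometry.dist_eq]
    have k₀ := key 0
    have k₁ := key 1
    rw [hZ.height_self hℓ h₀] at k₀ k₁
    linarith
  let T : ∀ g : Z ≃ᵢ Z, Commute g f → Y → Y := fun g hg y ↦
    ⟨hZ.axis f ℓ (g y) (-hZ.height f ℓ x₀ (g x₀)), (y.2.1.map hg).axis_mem hZ hℓ _, by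
      rw [h₀.height_axis hZ hℓ (y.2.1.map hg), hshift g hg y y.2.1, y.2.2]
      ring⟩
  have hT : ∀ g hg y t, g (E y t) = E (T g hg y) (t + hZ.height f ℓ x₀ (g x₀)) := by
    intro g hg y t
    change g (hZ.axis f ℓ y t) = hZ.axis f ℓ (hZ.axis f ℓ (g y) _) _
    rw [IsAxial.axis_axis hZ hℓ (y.2.1.map hg), hZ.map_axis hg]
    ring_nf
  have hEinj : ∀ {y y' s t}, E y s = E y' t → y = y' := by
    intro y y' s t h
    have := hE y y' s t
    rw [h, dist_self] at this
    have h₀ : dist y y' ^ 2 = 0 := by nlinarith [sq_nonneg (s - t), sq_nonneg (dist y y')]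
    exact dist_eq_zero.1 (pow_eq_zero_iff two_ne_zero |>.1 h₀)
  have hTT : ∀ g hg hg' y, T g⁻¹ hg' (T g hg y) = y := by
    intro g hg hg' y
    have h := hT g⁻¹ hg' (T g hg y) (0 + hZ.height f ℓ x₀ (g x₀))
    rw [← hT g hg] at h
    have e : g⁻¹ (g (E y 0)) = E y 0 := g.symm_apply_apply _
    rw [e] at h
    exact (hEinj h).symm
  refine ⟨Y, E, ⟨x₀, h₀, hZ.height_self hℓ h₀⟩, ?_, hE, fun y t ↦ hZ.map_axis_self f hℓ _ _,
    hsurj, fun g hg ↦ ?_⟩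
  · rintro ⟨y, hy, hy₀⟩ ⟨y', hy', hy₀'⟩ t ht
    have hu := hy.geo_mem hZ hy' ht
    exact ⟨⟨hZ.geo y y' t, hu, h₀.height_geo hZ hℓ hy hy' hy₀ hy₀' ht hu⟩,
      fun z ↦ hZ.dist_sq_geo_le y y' z ht⟩
  · refine ⟨⟨⟨T g hg, T g⁻¹ hg.inv_left, hTT g hg hg.inv_left, fun y ↦ ?_⟩,
      Isometry.of_dist_eq fun y y' ↦ ?_⟩, hZ.height f ℓ x₀ (g x₀), hT g hg⟩
    · have := hTT g⁻¹ hg.inv_left (by rwa [inv_inv]) y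
      simpa only [inv_inv] using this
    · have h₁ := hE (T g hg y) (T g hg y') (0 + hZ.height f ℓ x₀ (g x₀))
        (0 + hZ.height f ℓ x₀ (g x₀))
      rw [← hT g hg, ← hT g hg, g.isometry.dist_eq, hE] at h₁
      exact (sq_eq_sq₀ dist_nonneg dist_nonneg).1 (by linarith)

end StewartSpace

section Cube

open Finset

/-- The determinant of three vectors in `ℤ³`. -/
def det₃ (u v w : Fin 3 → ℤ) : ℤ :=
  u 0 * (v 1 * w 2 - v 2 * w 1) - u 1 * (v 0 * w 2 - v 2 * w 0) + u 2 * (v 0 * w 1 - v 1 * w 0)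

/-- Six times the signed volume of a simplex in `ℤ³`. -/
def vol₃ (p q r s : Fin 3 → ℤ) : ℤ :=
  det₃ q r s - det₃ p r s + det₃ p q s - det₃ p q r

/-- Twice the signed area of a triangle in `ℤ²`. -/
def area₂ (p q r : ℤ × ℤ) : ℤ :=
  (p.1 * q.2 - p.2 * q.1) + (q.1 * r.2 - q.2 * r.1) + (r.1 * p.2 - r.2 * p.1)

/-- A map from a grid to the plane which maps each side of the grid to the corresponding side of
the unit square has degree one. -/
lemma sum_area₂_grid {N : ℕ} {b : ℕ → ℕ → ℤ × ℤ} (h₁ : ∀ y, (b 0 y).1 = 0)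
    (h₂ : ∀ y, (b N y).1 = 1) (h₃ : ∀ x, (b x 0).2 = 0) (h₄ : ∀ x, (b x N).2 = 1) :
    ∑ x ∈ range N, ∑ y ∈ range N,
      (area₂ (b x y) (b (x + 1) y) (b (x + 1) (y + 1)) -
        area₂ (b x y) (b x (y + 1)) (b (x + 1) (y + 1))) = 2 := by
  let H : ℕ → ℕ → ℤ := fun x y ↦ (b x y).1 * (b (x + 1) y).2 - (b x y).2 * (b (x + 1) y).1
  let V : ℕ → ℕ → ℤ := fun x y ↦ (b x y).1 * (b x (y + 1)).2 - (b x y).2 * (b x (y + 1)).1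
  have key : ∀ x y, area₂ (b x y) (b (x + 1) y) (b (x + 1) (y + 1)) -
      area₂ (b x y) (b x (y + 1)) (b (x + 1) (y + 1)) =
        (V (x + 1) y - V x y) - (H x (y + 1) - H x y) := fun x y ↦ by
    simp only [area₂, V, H]; ring
  have hV : ∑ x ∈ range N, ∑ y ∈ range N, (V (x + 1) y - V x y) = 1 := by
    rw [sum_comm]
    simp only [fun y ↦ sum_range_sub (fun x ↦ V x y) N]
    simp only [V, h₁, h₂, one_mul, mul_one, zero_mul, mul_zero, sub_zero]
    rw [sum_range_sub (fun y ↦ (b N y).2), h₃, h₄, sub_zero]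
  have hH : ∑ x ∈ range N, ∑ y ∈ range N, (H x (y + 1) - H x y) = -1 := by
    simp only [fun x ↦ sum_range_sub (fun y ↦ H x y) N]
    simp only [H, h₃, h₄, one_mul, mul_one, zero_mul, mul_zero, sub_zero]
    rw [← neg_inj, ← sum_neg_distrib]
    simp only [neg_sub]
    rw [sum_range_sub (fun x ↦ (b x N).1), h₁, h₂]
    norm_num
  simp only [key]
  simp only [sum_sub_distrib (fun y ↦ V _ y - V _ y), sum_sub_distrib (fun x ↦ ∑ y ∈ _, _), hV, hH]
  norm_num

/-- A map from a grid to the space which maps each side of the grid to the corresponding side of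
the unit cube has nonzero degree, hence does not collapse all simplices of the grid. -/
lemma exists_vol₃_ne_zero {N : ℕ} {b : ℕ → ℕ → ℕ → Fin 3 → ℤ} (h₁ : ∀ y z, b 0 y z 0 = 0)
    (h₂ : ∀ y z, b N y z 0 = 1) (h₃ : ∀ x z, b x 0 z 1 = 0) (h₄ : ∀ x z, b x N z 1 = 1)
    (h₅ : ∀ x y, b x y 0 2 = 0) (h₆ : ∀ x y, b x y N 2 = 1) :
    ∃ x y z x₁ y₁ z₁ x₂ y₂ z₂, (x₁ = x ∨ x₁ = x + 1) ∧ (y₁ = y ∨ y₁ = y + 1) ∧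
      (z₁ = z ∨ z₁ = z + 1) ∧ (x₂ = x ∨ x₂ = x + 1) ∧ (y₂ = y ∨ y₂ = y + 1) ∧
      (z₂ = z ∨ z₂ = z + 1) ∧
      vol₃ (b x y z) (b x₁ y₁ z₁) (b x₂ y₂ z₂) (b (x + 1) (y + 1) (z + 1)) ≠ 0 := by
  by_contra! hc
  let F₁ : ℕ → ℕ → ℕ → ℤ := fun x y z ↦
    det₃ (b x y z) (b x (y + 1) z) (b x (y + 1) (z + 1)) -
      det₃ (b x y z) (b x y (z + 1)) (b x (y + 1) (z + 1))
  let F₂ : ℕ → ℕ → ℕ → ℤ := fun x y z ↦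
    det₃ (b x y z) (b x y (z + 1)) (b (x + 1) y (z + 1)) -
      det₃ (b x y z) (b (x + 1) y z) (b (x + 1) y (z + 1))
  let F₃ : ℕ → ℕ → ℕ → ℤ := fun x y z ↦
    det₃ (b x y z) (b (x + 1) y z) (b (x + 1) (y + 1) z) -
      det₃ (b x y z) (b x (y + 1) z) (b (x + 1) (y + 1) z)
  have key : ∀ x y z, (F₁ (x + 1) y z - F₁ x y z) + (F₂ x (y + 1) z - F₂ x y z) +
      (F₃ x y (z + 1) - F₃ x y z) = 0 := by
    intro x y z
    have v₁ := hc x y z (x + 1) y z (x + 1) (y + 1) z (by simp) (by simp) (by simp) (by simp)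
      (by simp) (by simp)
    have v₂ := hc x y z (x + 1) y z (x + 1) y (z + 1) (by simp) (by simp) (by simp) (by simp)
      (by simp) (by simp)
    have v₃ := hc x y z x (y + 1) z (x + 1) (y + 1) z (by simp) (by simp) (by simp) (by simp)
      (by simp) (by simp)
    have v₄ := hc x y z x (y + 1) z x (y + 1) (z + 1) (by simp) (by simp) (by simp) (by simp)
      (by simp) (by simp)
    have v₅ := hc x y z x y (z + 1) (x + 1) y (z + 1) (by simp) (by simp) (by simp) (by simp)
      (by simp) (by simp)
    have v₆ := hc x y z x y (z + 1) x (y + 1) (z + 1) (by simp) (by simp) (by simp) (by simp)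
      (by simp) (by simp)
    have : (F₁ (x + 1) y z - F₁ x y z) + (F₂ x (y + 1) z - F₂ x y z) +
        (F₃ x y (z + 1) - F₃ x y z) =
        vol₃ (b x y z) (b (x + 1) y z) (b (x + 1) (y + 1) z) (b (x + 1) (y + 1) (z + 1)) -
        vol₃ (b x y z) (b (x + 1) y z) (b (x + 1) y (z + 1)) (b (x + 1) (y + 1) (z + 1)) -
        vol₃ (b x y z) (b x (y + 1) z) (b (x + 1) (y + 1) z) (b (x + 1) (y + 1) (z + 1)) +
        vol₃ (b x y z) (b x (y + 1) z) (b x (y + 1) (z + 1)) (b (x + 1) (y + 1) (z + 1)) +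
        vol₃ (b x y z) (b x y (z + 1)) (b (x + 1) y (z + 1)) (b (x + 1) (y + 1) (z + 1)) -
        vol₃ (b x y z) (b x y (z + 1)) (b x (y + 1) (z + 1)) (b (x + 1) (y + 1) (z + 1)) := by
      simp only [F₁, F₂, F₃, vol₃, det₃]
      ring
    rw [this, v₁, v₂, v₃, v₄, v₅, v₆]
    norm_num
  have s₁ : ∑ y ∈ range N, ∑ z ∈ range N, ∑ x ∈ range N, (F₁ (x + 1) y z - F₁ x y z) = 2 := by
    simp only [fun y z ↦ sum_range_sub (fun x ↦ F₁ x y z) N]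
    rw [← sum_area₂_grid (b := fun y z ↦ (b N y z 1, b N y z 2)) (N := N) (fun z ↦ h₃ _ _)
      (fun z ↦ h₄ _ _) (fun y ↦ h₅ _ _) (fun y ↦ h₆ _ _)]
    refine sum_congr rfl fun y _ ↦ sum_congr rfl fun z _ ↦ ?_
    simp only [F₁, det₃, area₂, h₁, h₂]
    ring
  have s₂ : ∑ x ∈ range N, ∑ z ∈ range N, ∑ y ∈ range N, (F₂ x (y + 1) z - F₂ x y z) = 2 := by
    simp only [fun x z ↦ sum_range_sub (fun y ↦ F₂ x y z) N]
    rw [sum_comm]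
    rw [← sum_area₂_grid (b := fun z x ↦ (b x N z 2, b x N z 0)) (N := N) (fun z ↦ h₅ _ _)
      (fun z ↦ h₆ _ _) (fun y ↦ h₁ _ _) (fun y ↦ h₂ _ _)]
    refine sum_congr rfl fun y _ ↦ sum_congr rfl fun z _ ↦ ?_
    simp only [F₂, det₃, area₂, h₃, h₄]
    ring
  have s₃ : ∑ x ∈ range N, ∑ y ∈ range N, ∑ z ∈ range N, (F₃ x y (z + 1) - F₃ x y z) = 2 := by
    simp only [fun x y ↦ sum_range_sub (fun z ↦ F₃ x y z) N]
    rw [← sum_area₂_grid (b := fun x y ↦ (b x y N 0, b x y N 1)) (N := N) (fun z ↦ h₁ _ _)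
      (fun z ↦ h₂ _ _) (fun y ↦ h₃ _ _) (fun y ↦ h₄ _ _)]
    refine sum_congr rfl fun y _ ↦ sum_congr rfl fun z _ ↦ ?_
    simp only [F₃, det₃, area₂, h₅, h₆]
    ring
  have s : ∑ x ∈ range N, ∑ y ∈ range N, ∑ z ∈ range N, ((F₁ (x + 1) y z - F₁ x y z) +
      (F₂ x (y + 1) z - F₂ x y z) + (F₃ x y (z + 1) - F₃ x y z)) = 0 := by
    simp only [key, sum_const_zero]
  have c₁ : ∑ x ∈ range N, ∑ y ∈ range N, ∑ z ∈ range N, (F₁ (x + 1) y z - F₁ x y z) = 2 := by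
    rw [sum_comm, ← s₁]
    exact sum_congr rfl fun y _ ↦ sum_comm
  have c₂ : ∑ x ∈ range N, ∑ y ∈ range N, ∑ z ∈ range N, (F₂ x (y + 1) z - F₂ x y z) = 2 := by
    rw [← s₂]
    exact sum_congr rfl fun y _ ↦ sum_comm
  simp only [sum_add_distrib, c₁, c₂, s₃] at s
  norm_num at s

lemma CovDimLE.exists_eq_of_continuous {X : Type*} [TopologicalSpace X] [T2Space X]
    (hX : CovDimLE X 2) {h : (Fin 3 → unitInterval) → X} (hh : Continuous h) :
    ∃ i u v, u i = 0 ∧ v i = 1 ∧ h u = h v := by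
  classical
  by_contra! hc
  let C : Fin 3 → unitInterval → Set X := fun i t ↦ h '' {u | u i = t}
  have hC : ∀ i t, IsClosed (C i t) := fun i t ↦
    ((isClosed_singleton.preimage (continuous_apply i)).isCompact.image hh).isClosed
  have hCd : ∀ i x, x ∈ C i 0 → x ∉ C i 1 := by
    rintro i _ ⟨u, hu, rfl⟩ ⟨v, hv, e⟩
    exact hc i u v hu hv e.symm
  obtain ⟨V, hVo, hVc, hVU, hV⟩ := hX
    {u | IsOpen u ∧ ∀ i, Disjoint u (C i 0) ∨ Disjoint u (C i 1)} (fun u hu ↦ hu.1) (by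
      refine eq_univ_of_forall fun x ↦ ⟨⋂ i, if x ∈ C i 0 then (C i 1)ᶜ else (C i 0)ᶜ,
        ⟨isOpen_iInter_of_finite fun i ↦ ?_, fun i ↦ ?_⟩, mem_iInter.2 fun i ↦ ?_⟩
      · split_ifs
        exacts [(hC i 1).isOpen_compl, (hC i 0).isOpen_compl]
      · by_cases hx : x ∈ C i 0
        · refine .inr (Set.disjoint_left.2 fun y hy ↦ ?_)
          simpa [hx] using mem_iInter.1 hy i
        · refine .inl (Set.disjoint_left.2 fun y hy ↦ ?_)
          simpa [hx] using mem_iInter.1 hy i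
      · by_cases hx : x ∈ C i 0
        · simpa [hx] using hCd i x hx
        · simp [hx])
  obtain ⟨δ, hδ, hball⟩ := lebesgue_number_lemma_of_metric
    (s := (univ : Set (Fin 3 → unitInterval))) (c := fun v : V ↦ h ⁻¹' v.1) isCompact_univ (fun v ↦ (hVo v.1 v.2).preimage hh) (fun u _ ↦ by
      obtain ⟨v, hv, hu⟩ := hVc.symm ▸ mem_univ (h u)
      exact mem_iUnion.2 ⟨⟨v, hv⟩, hu⟩)
  choose v hv using fun u ↦ hball u (mem_univ u)
  obtain ⟨N, hN⟩ := exists_nat_one_div_lt hδ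
  let c : ℕ → unitInterval := fun n ↦ projIcc 0 1 zero_le_one ((n : ℝ) / ((N + 1 : ℕ) : ℝ))
  have hc₀ : c 0 = 0 := by simp [c]
  have hc₁ : c (N + 1) = 1 := by
    simp only [c]
    rw [div_self (by positivity)]
    exact projIcc_right _
  have hcd : ∀ m n, n = m ∨ n = m + 1 → dist (c m) (c n) < δ := by
    intro m n hmn
    refine lt_of_le_of_lt ?_ hN
    refine (LipschitzWith.projIcc _).dist_le_mul _ _ |>.trans ?_
    rw [NNReal.coe_one, one_mul, Real.dist_eq, ← sub_div]
    rcases hmn with rfl | rfl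
    · simp; positivity
    · push_cast
      rw [abs_div, abs_of_pos (by positivity : (0 : ℝ) < N + 1)]
      simp
  let pt : ℕ → ℕ → ℕ → Fin 3 → unitInterval := fun x y z ↦ ![c x, c y, c z]
  let β : Set X → Fin 3 → ℤ := fun v i ↦ if (v ∩ C i 0).Nonempty then 0 else 1
  have hmem : ∀ u, h u ∈ (v u).1 := fun u ↦ hv u (Metric.mem_ball_self hδ)
  have hβ₀ : ∀ u i, u i = 0 → β (v u) i = 0 := fun u i hu ↦
    if_pos ⟨h u, hmem u, u, hu, rfl⟩
  have hβ₁ : ∀ u i, u i = 1 → β (v u) i = 1 := fun u i hu ↦ by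
    refine if_neg fun hne ↦ ?_
    obtain ⟨w, ⟨-, hw⟩, hvw⟩ := hVU _ (v u).2
    rcases hw i with hw | hw
    · obtain ⟨y, hy, hy'⟩ := hne
      exact Set.disjoint_left.1 hw (hvw hy) hy'
    · exact Set.disjoint_left.1 hw (hvw (hmem u)) ⟨u, hu, rfl⟩
  obtain ⟨x, y, z, x₁, y₁, z₁, x₂, y₂, z₂, hx₁, hy₁, hz₁, hx₂, hy₂, hz₂, hne⟩ :=
    exists_vol₃_ne_zero (N := N + 1) (b := fun x y z ↦ β (v (pt x y z)))
      (fun _ _ ↦ hβ₀ _ _ (by simp [pt, hc₀])) (fun _ _ ↦ hβ₁ _ _ (by simp [pt, hc₁]))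
      (fun _ _ ↦ hβ₀ _ _ (by simp [pt, hc₀])) (fun _ _ ↦ hβ₁ _ _ (by simp [pt, hc₁]))
      (fun _ _ ↦ hβ₀ _ _ (by simp [pt, hc₀])) (fun _ _ ↦ hβ₁ _ _ (by simp [pt, hc₁]))
  obtain ⟨F, hF, hVF⟩ := hV (h (pt x y z))
  have hFm : ∀ x' y' z', (x' = x ∨ x' = x + 1) → (y' = y ∨ y' = y + 1) → (z' = z ∨ z' = z + 1) →
      (v (pt x' y' z')).1 ∈ F := fun x' y' z' hx hy hz ↦ by
    refine hVF ⟨(v _).2, hv (pt x' y' z') ?_⟩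
    rw [Metric.mem_ball, dist_pi_lt_iff hδ]
    intro i
    fin_cases i
    exacts [hcd _ _ hx, hcd _ _ hy, hcd _ _ hz]
  have m₀ := hFm x y z (by simp) (by simp) (by simp)
  have m₁ := hFm x₁ y₁ z₁ hx₁ hy₁ hz₁
  have m₂ := hFm x₂ y₂ z₂ hx₂ hy₂ hz₂
  have m₃ := hFm (x + 1) (y + 1) (z + 1) (by simp) (by simp) (by simp)
  revert m₀ m₁ m₂ m₃ hne
  generalize (v (pt x y z)).1 = a₀
  generalize (v (pt x₁ y₁ z₁)).1 = a₁
  generalize (v (pt x₂ y₂ z₂)).1 = a₂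
  generalize (v (pt (x + 1) (y + 1) (z + 1))).1 = a₃
  intro hne m₀ m₁ m₂ m₃
  have hd : a₀ ≠ a₁ ∧ a₀ ≠ a₂ ∧ a₀ ≠ a₃ ∧ a₁ ≠ a₂ ∧ a₁ ≠ a₃ ∧ a₂ ≠ a₃ := by
    refine ⟨?_, ?_, ?_, ?_, ?_, ?_⟩ <;>
    · rintro rfl
      refine hne ?_
      simp only [vol₃, det₃]
      ring
  have hcard : ({a₀, a₁, a₂, a₃} : Finset (Set X)).card = 4 := by
    simp [hd]
  have hsub : ({a₀, a₁, a₂, a₃} : Finset (Set X)) ⊆ F := by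
    simp [Finset.insert_subset_iff, m₀, m₁, m₂, m₃]
  have := Finset.card_le_card hsub
  omega

end Cube

namespace StewartSpace

variable {Z : Type*} [MetricSpace Z]

lemma continuous_geo (hZ : StewartSpace Z) {T : Type*} [TopologicalSpace T] {x y : T → Z}
    {t : T → unitInterval} (hx : Continuous x) (hy : Continuous y) (ht : Continuous t) :
    Continuous fun a ↦ hZ.geo (x a) (y a) (t a) := by
  refine continuous_iff_continuousAt.2 fun a ↦ tendsto_iff_dist_tendsto_zero.2 ?_
  have hlim : Filter.Tendsto (fun a' ↦ dist (x a') (x a) + dist (y a') (y a) +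
      |(t a' : ℝ) - t a| * dist (x a) (y a)) (nhds a) (nhds 0) := by
    have : Continuous fun a' ↦ dist (x a') (x a) + dist (y a') (y a) +
      |(t a' : ℝ) - t a| * dist (x a) (y a) := by fun_prop
    simpa using this.tendsto a
  refine squeeze_zero (fun _ ↦ dist_nonneg) (fun a' ↦ ?_) hlim
  refine (dist_triangle _ (hZ.geo (x a) (y a) (t a')) _).trans (add_le_add ?_
    (hZ.dist_geo_geo_le_abs _ _ (t a').2 (t a).2))
  refine (hZ.dist_geo_geo_le _ _ _ _ (t a').2).trans ?_
  have h₁ : (1 - (t a' : ℝ)) * dist (x a') (x a) ≤ dist (x a') (x a) :=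
    mul_le_of_le_one_left dist_nonneg (by linarith [(t a').2.1])
  have h₂ : (t a' : ℝ) * dist (y a') (y a) ≤ dist (y a') (y a) :=
    mul_le_of_le_one_left dist_nonneg (t a').2.2
  linarith

/-- If the product of `Y` with a line embeds into a two-dimensional space, then `Y` contains no
embedded quadrilateral. -/
lemma exists_geo_eq_geo {X Y : Type*} [MetricSpace X] [MetricSpace Y] (hY : StewartSpace Y)
    (hX : CovDimLE X 2) {E : Y → ℝ → X}
    (hE : ∀ y y' s t, dist (E y s) (E y' t) ^ 2 = dist y y' ^ 2 + (s - t) ^ 2) (p q r s : Y) :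
    (∃ t ∈ Icc (0 : ℝ) 1, ∃ t' ∈ Icc (0 : ℝ) 1, hY.geo p q t = hY.geo r s t') ∨
      ∃ t ∈ Icc (0 : ℝ) 1, ∃ t' ∈ Icc (0 : ℝ) 1, hY.geo p r t = hY.geo q s t' := by
  have hEc : Continuous fun a : Y × ℝ ↦ E a.1 a.2 := by
    refine continuous_iff_continuousAt.2 fun a ↦ tendsto_iff_dist_tendsto_zero.2 ?_
    have : Continuous fun a' : Y × ℝ ↦ √(dist a'.1 a.1 ^ 2 + (a'.2 - a.2) ^ 2) := by fun_prop
    have hlim := this.tendsto a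
    simp only [dist_self, sub_self, ne_eq, OfNat.ofNat_ne_zero, not_false_eq_true, zero_pow,
      add_zero, Real.sqrt_zero] at hlim
    refine hlim.congr fun a' ↦ ?_
    rw [← hE, Real.sqrt_sq dist_nonneg]
  have hEinj : ∀ {y y' s t}, E y s = E y' t → y = y' ∧ s = t := by
    intro y y' s t h
    have := hE y y' s t
    rw [h, dist_self] at this
    have h₁ : dist y y' ^ 2 = 0 := by nlinarith [sq_nonneg (s - t), sq_nonneg (dist y y')]
    have h₂ : (s - t) ^ 2 = 0 := by nlinarith [sq_nonneg (s - t), sq_nonneg (dist y y')]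
    exact ⟨dist_eq_zero.1 (pow_eq_zero_iff two_ne_zero |>.1 h₁),
      sub_eq_zero.1 (pow_eq_zero_iff two_ne_zero |>.1 h₂)⟩
  let k : (Fin 3 → unitInterval) → Y := fun u ↦
    hY.geo (hY.geo p q (u 0)) (hY.geo r s (u 0)) (u 1)
  have hk : Continuous k := hY.continuous_geo
    (hY.continuous_geo continuous_const continuous_const (continuous_apply 0))
    (hY.continuous_geo continuous_const continuous_const (continuous_apply 0)) (continuous_apply 1)
  obtain ⟨i, u, v, hu, hv, h⟩ := hX.exists_eq_of_continuous (h := fun u ↦ E (k u) (u 2))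
    (hEc.comp (hk.prodMk (continuous_subtype_val.comp (continuous_apply 2))))
  obtain ⟨h₁, h₂⟩ := hEinj h
  fin_cases i
  · refine .inr ⟨u 1, (u 1).2, v 1, (v 1).2, ?_⟩
    simpa [k, show u 0 = 0 from hu, show v 0 = 1 from hv, geo_zero, geo_one] using h₁
  · refine .inl ⟨u 0, (u 0).2, v 0, (v 0).2, ?_⟩
    simpa [k, show u 1 = 0 from hu, show v 1 = 1 from hv, geo_zero, geo_one] using h₁
  · rw [show u 2 = 0 from hu, show v 2 = 1 from hv] at h₂
    simp at h₂

lemma add_dist_le_of_geo_eq_geo (hZ : StewartSpace Z) {p q r s : Z} {t t' : ℝ}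
    (ht : t ∈ Icc (0 : ℝ) 1) (ht' : t' ∈ Icc (0 : ℝ) 1) (h : hZ.geo p q t = hZ.geo r s t') :
    dist p s + dist q r ≤ dist p q + dist r s := by
  have h₁ := hZ.dist_left_geo p q ht
  have h₂ := hZ.dist_geo_right p q ht
  have h₃ := hZ.dist_left_geo r s ht'
  have h₄ := hZ.dist_geo_right r s ht'
  rw [← h] at h₃ h₄
  have h₅ := dist_triangle p (hZ.geo p q t) s
  have h₆ := dist_triangle_left q r (hZ.geo p q t)
  linarith [dist_comm r (hZ.geo p q t)]

/-- If the product of `Y` with a line embeds into a two-dimensional space, then `Y` is a tree. -/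
lemma four_point {X Y : Type*} [MetricSpace X] [MetricSpace Y] (hY : StewartSpace Y)
    (hX : CovDimLE X 2) {E : Y → ℝ → X}
    (hE : ∀ y y' s t, dist (E y s) (E y' t) ^ 2 = dist y y' ^ 2 + (s - t) ^ 2) (x y z w : Y) :
    dist x y + dist z w ≤ max (dist x z + dist y w) (dist x w + dist y z) := by
  rcases hY.exists_geo_eq_geo hX hE x z w y with ⟨t, ht, t', ht', h⟩ | ⟨t, ht, t', ht', h⟩
  · refine le_max_of_le_left ?_
    rw [dist_comm y w]
    exact hY.add_dist_le_of_geo_eq_geo ht ht' h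
  · refine le_max_of_le_right ?_
    rw [dist_comm y z, dist_comm z w]
    exact hY.add_dist_le_of_geo_eq_geo ht ht' h

/-- An isometry of a tree is either elliptic or hyperbolic. -/
lemma exists_fixed_or_isAxial (hZ : StewartSpace Z) (h4 : ∀ x y z w : Z,
    dist x y + dist z w ≤ max (dist x z + dist y w) (dist x w + dist y z))
    (b : Z ≃ᵢ Z) (x : Z) : ∃ q, b q = q ∨ ∃ l > 0, IsAxial b l q := by
  set d := dist x (b x) with hd
  have hd' : dist (b x) (b (b x)) = d := b.isometry.dist_eq _ _
  set D := dist x (b (b x)) with hD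
  set q := hZ.geo x (b x) (1 / 2) with hq
  have h₁ : dist x q = d / 2 := by rw [hq, hZ.dist_left_geo _ _ half_mem_Icc]; ring
  have h₂ : dist q (b x) = d / 2 := by rw [hq, hZ.dist_geo_right _ _ half_mem_Icc]; ring
  have h₃ : dist (b x) (b q) = d / 2 := by rw [b.isometry.dist_eq, h₁]
  have h₄ : dist (b q) (b (b x)) = d / 2 := by rw [b.isometry.dist_eq, h₂]
  have h₅ : dist (b (b x)) (b (b q)) = d / 2 := by rw [b.isometry.dist_eq, h₃]
  have k₁ := h4 q (b (b x)) x (b x)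
  have k₂ := h4 q (b q) (b (b x)) (b x)
  rw [dist_comm q x, dist_comm (b (b x)) (b x), h₁, h₂, hd', dist_comm (b (b x)) x, ← hd, ← hD]
    at k₁
  rw [dist_comm (b (b x)) (b x), hd', dist_comm (b q) (b x), h₃, h₂, h₄] at k₂
  have hd₀ : 0 ≤ d := dist_nonneg
  refine ⟨q, ?_⟩
  rcases le_or_gt D d with hle | hlt
  · left
    have e₁ : dist q (b (b x)) ≤ d / 2 := by
      have := max_le (a := d / 2 + d) (b := d / 2 + D) (c := d / 2 + d) le_rfl (by linarith)
      linarith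
    have e₂ : dist q (b q) ≤ 0 := by
      have := max_le (a := dist q (b (b x)) + d / 2) (b := d / 2 + d / 2) (c := d) (by linarith)
        (by linarith)
      linarith
    exact (dist_le_zero.1 e₂).symm
  · right
    have e₁ : dist q (b (b x)) ≤ D - d / 2 := by
      have := max_le (a := d / 2 + d) (b := d / 2 + D) (c := d / 2 + D) (by linarith) le_rfl
      linarith
    have e₂ : dist q (b q) ≤ D - d := by
      have := max_le (a := dist q (b (b x)) + d / 2) (b := d / 2 + d / 2) (c := D) (by linarith)
        (by linarith)
      linarith
    have t₁ := dist_triangle x q (b (b x))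
    have t₂ := dist_triangle q (b q) (b (b x))
    have e₃ : dist q (b q) = D - d := by linarith
    have e₄ : dist (b q) (b (b q)) = D - d := by rw [b.isometry.dist_eq, e₃]
    refine ⟨D - d, by linarith, e₃, le_antisymm (by linarith [dist_triangle q (b q) (b (b q))]) ?_⟩
    have t₃ := dist_triangle x (b q) (b (b x))
    have e₅ : dist (b x) (b (b q)) = dist x (b q) := b.isometry.dist_eq _ _
    have k₃ := h4 q (b (b x)) (b x) (b (b q))
    rw [h₂, h₅, dist_comm (b (b x)) (b x), hd', e₅] at k₃
    rcases le_max_iff.1 k₃ with h | h <;> linarith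

/-- A hyperbolic isometry of a tree has only one axis. -/
lemma IsAxial.exists_axis_eq (hZ : StewartSpace Z) (h4 : ∀ x y z w : Z,
    dist x y + dist z w ≤ max (dist x z + dist y w) (dist x w + dist y z))
    {b : Z ≃ᵢ Z} {l : ℝ} (hl : 0 < l) {p q : Z} (hp : IsAxial b l p) (hq : IsAxial b l q) :
    ∃ τ, hZ.axis b l q τ = p := by
  obtain ⟨τ, ω, hω, h⟩ := hp.exists_dist_sq_eq hZ hl hq
  refine ⟨τ, ?_⟩
  have h₁ := h 0 τ
  have h₂ := h 1 (1 + τ)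
  have h₃ := h 0 (1 + τ)
  have h₄ := h 1 τ
  have k := h4 (hZ.axis b l p 0) (hZ.axis b l q (1 + τ)) (hZ.axis b l p 1) (hZ.axis b l q τ)
  rw [hp.dist_axis hZ hl, hq.dist_axis hZ hl, dist_comm (hZ.axis b l q (1 + τ))] at k
  rw [hZ.axis_zero] at *
  have hω₀ : ω = 0 := by
    by_contra hne
    have hpos : 0 < ω := lt_of_le_of_ne hω (Ne.symm hne)
    ring_nf at h₁ h₂ h₃ h₄
    have g₁ : 1 < dist p (hZ.axis b l q (1 + τ)) := by
      refine lt_of_pow_lt_pow_left₀ 2 dist_nonneg ?_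
      linarith
    have g₂ : 1 < dist (hZ.axis b l p 1) (hZ.axis b l q τ) := by
      refine lt_of_pow_lt_pow_left₀ 2 dist_nonneg ?_
      linarith
    have g₃ : dist p (hZ.axis b l q τ) < dist p (hZ.axis b l q (1 + τ)) := by
      refine lt_of_pow_lt_pow_left₀ 2 dist_nonneg ?_
      linarith
    have g₄ : dist (hZ.axis b l p 1) (hZ.axis b l q (1 + τ)) <
        dist (hZ.axis b l p 1) (hZ.axis b l q τ) := by
      refine lt_of_pow_lt_pow_left₀ 2 dist_nonneg ?_
      linarith
    have g₅ : |1 + τ - τ| = 1 := by norm_num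
    have g₆ : |(0 : ℝ) - 1| = 1 := by norm_num
    rw [g₅, g₆] at k
    rcases le_max_iff.1 k with h | h <;> linarith
  have : dist p (hZ.axis b l q τ) ^ 2 = 0 := by rw [h₁, hω₀]; ring
  exact (dist_eq_zero.1 (pow_eq_zero_iff two_ne_zero |>.1 this)).symm

end StewartSpace

lemma zpow_apply_of_translation {Z T : Type*} [MetricSpace Z] [AddCommGroup T] {f : Z ≃ᵢ Z}
    {c : T → Z} {v : T} (h : ∀ t, f (c t) = c (t + v)) (n : ℤ) (t : T) :
    (f ^ n) (c t) = c (t + n • v) := by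
  induction n generalizing t with
  | zero => simp
  | succ n ih => rw [zpow_add_one, IsometryEquiv.mul_apply, h, ih, add_one_zsmul]; congr 1; abel
  | pred n ih =>
    have hinv : f⁻¹ (c t) = c (t - v) := by
      conv_lhs => rw [← sub_add_cancel t v, ← h]
      exact f.symm_apply_apply _
    rw [zpow_sub_one, IsometryEquiv.mul_apply, hinv, ih, sub_one_zsmul]; congr 1; abel

lemma Isometry.map_lineMap {Z V : Type*} [MetricSpace Z] [NormedAddCommGroup V]
    [NormedSpace ℝ V] (hZ : StewartSpace Z) {f : V → Z} (hf : Isometry f) (a b : V) {t : ℝ}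
    (ht : t ∈ Icc (0 : ℝ) 1) : f (AffineMap.lineMap a b t) = hZ.geo (f a) (f b) t :=
  hZ.eq_geo ht
    (by rw [hf.dist_eq, hf.dist_eq, dist_left_lineMap, Real.norm_of_nonneg ht.1])
    (by rw [hf.dist_eq, hf.dist_eq, dist_lineMap_right, Real.norm_of_nonneg (by linarith [ht.2])])

namespace StewartSpace

variable {Z : Type*} [MetricSpace Z]

/-- The nearest point projection to a flat subspace decreases displacements. -/
lemma exists_dist_map_le {V : Type*} [NormedAddCommGroup V] [NormedSpace ℝ V]
    [FiniteDimensional ℝ V] (hZ : StewartSpace Z) {f : V → Z} (hf : Isometry f) (x : Z) :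
    ∃ y ∈ range f, ∀ g : Z ≃ᵢ Z, g '' range f = range f → dist y (g y) ≤ dist x (g x) := by
  have : ProperSpace V := FiniteDimensional.proper ℝ V
  have hlim : Filter.Tendsto (fun p ↦ dist x (f p)) (Filter.cocompact V) Filter.atTop := by
    refine Filter.tendsto_atTop_mono (fun p ↦ ?_) (Filter.tendsto_atTop_add_const_right _
      (-dist x (f 0)) (tendsto_dist_left_cocompact_atTop (0 : V)))
    rw [← hf.dist_eq]
    linarith [dist_triangle_left (f 0) (f p) x]
  obtain ⟨p, hp⟩ := Continuous.exists_forall_le (continuous_const.dist hf.continuous) hlim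
  have key : ∀ z ∈ range f, dist x (f p) ^ 2 + dist (f p) z ^ 2 ≤ dist x z ^ 2 := by
    rintro _ ⟨r, rfl⟩
    have hl : Filter.Tendsto (fun t : ℝ ↦ dist x (f p) ^ 2 + (1 - t) * dist (f p) (f r) ^ 2)
        (nhdsWithin 0 (Ioi 0)) (nhds (dist x (f p) ^ 2 + dist (f p) (f r) ^ 2)) := by
      have : Continuous fun t : ℝ ↦ dist x (f p) ^ 2 + (1 - t) * dist (f p) (f r) ^ 2 := by
        fun_prop
      simpa using (this.tendsto 0).mono_left nhdsWithin_le_nhds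
    refine le_of_tendsto hl (Filter.mem_of_superset (Ioc_mem_nhdsGT one_pos) fun t ht ↦ ?_)
    have ht' : t ∈ Icc (0 : ℝ) 1 := ⟨ht.1.le, ht.2⟩
    have h₁ := hZ.dist_sq_geo_le (f p) (f r) x ht'
    rw [← hf.map_lineMap hZ p r ht'] at h₁
    have h₂ := pow_le_pow_left₀ dist_nonneg (hp (AffineMap.lineMap p r t)) 2
    refine le_of_mul_le_mul_left ?_ ht.1
    linarith
  refine ⟨f p, mem_range_self p, fun g hg ↦ ?_⟩
  have h₁ := key (g (f p)) (hg ▸ mem_image_of_mem g (mem_range_self p))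
  obtain ⟨z, hz, hzp⟩ : f p ∈ g '' range f := hg.symm ▸ mem_range_self p
  have h₂ := key z hz
  rw [← g.isometry.dist_eq (f p), ← g.isometry.dist_eq x z, hzp, ← g.isometry.dist_eq x] at h₂
  have h₃ := hZ.sq_add_sq_diagonals_le x (f p) (g (f p)) (g x)
  rw [g.isometry.dist_eq x] at h₂
  rw [dist_comm (g (f p)) (g x), g.isometry.dist_eq, dist_comm (g x) x, dist_comm (f p) (g x)] at h₃
  rw [dist_comm (g (f p)) (f p)] at h₂
  refine abs_le_of_sq_le_sq' ?_ dist_nonneg |>.2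
  linarith

/-- A pair of commuting isometries of a two-dimensional space, one of which is hyperbolic, acts by
translations on a line or on a plane. -/
lemma exists_line_or_plane (hZ : StewartSpace Z) (hdim : CovDimLE Z 2) {f g : Z ≃ᵢ Z}
    (hgf : Commute g f) {ℓ : ℝ} (hℓ : 0 < ℓ) {x₀ : Z} (h₀ : IsAxial f ℓ x₀) :
    (∃ (c : ℝ → Z) (β : ℝ), Isometry c ∧ (∀ t, f (c t) = c (t + ℓ)) ∧
      ∀ t, g (c t) = c (t + β)) ∨
    ∃ (e : EuclideanSpace ℝ (Fin 2) → Z) (l β : ℝ), 0 < l ∧ Isometry e ∧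
      (∀ p, f (e p) = e (p + !₂[0, ℓ])) ∧ (∀ p, g (e p) = e (p + !₂[l, β])) ∧
      ∀ x, x ∈ MinSet f → x ∈ MinSet g → x ∈ range e := by
  obtain ⟨Y, E, hYne, hY, hE, hEf, hEs, hEg⟩ := hZ.exists_product_decomposition hℓ h₀
  obtain ⟨b, β, hb⟩ := hEg g hgf
  have h4 := hY.four_point hdim hE
  have := hYne.to_subtype
  obtain ⟨q, hq | ⟨l, hl, hq⟩⟩ := hY.exists_fixed_or_isAxial h4 b (Classical.arbitrary Y)
  · refine .inl ⟨E q, β, Isometry.of_dist_eq fun s t ↦ ?_, fun t ↦ hEf q t, fun t ↦ ?_⟩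
    · rw [← sq_eq_sq₀ dist_nonneg dist_nonneg, hE, dist_self, Real.dist_eq, sq_abs]; ring
    · rw [hb, hq]
  · let e : EuclideanSpace ℝ (Fin 2) → Z := fun v ↦ E (hY.axis b l q (v 0)) (v 1)
    have he : Isometry e := Isometry.of_dist_eq fun v w ↦ by
      rw [← sq_eq_sq₀ dist_nonneg dist_nonneg, hE, hq.dist_axis hY hl, sq_abs,
        EuclideanSpace.dist_sq_fin_two]
    have heg : ∀ p, g (e p) = e (p + !₂[l, β]) := fun p ↦ by
      simp [e, hb, hY.map_axis_self b hl]
    refine .inr ⟨e, l, β, hl, he, fun p ↦ by simp [e, hEf], heg, fun x hxf hxg ↦ ?_⟩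
    obtain ⟨y, s, rfl⟩ := hEs x (by
      rw [← h₀.transLen_eq hZ]
      exact (hZ.isAxial_iff_mem_minSet).2 hxf)
    have hle : transLen g ≤ dist (e 0) (g (e 0)) :=
      csInf_le ⟨0, by rintro _ ⟨z, rfl⟩; exact dist_nonneg⟩ (mem_range_self (e 0))
    have hxg' : dist (E y s) (g (E y s)) = transLen g := hxg
    rw [← hxg', heg, he.dist_eq, ← sq_le_sq₀ dist_nonneg dist_nonneg, hb, hE,
      EuclideanSpace.dist_sq_fin_two] at hle
    have hle' : dist y (b y) ≤ l := by
      refine abs_le_of_sq_le_sq' ?_ hl.le |>.2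
      simp at hle
      linarith
    have hy : IsAxial b l y := by
      have e₁ : dist y (b y) = l := le_antisymm hle' (hq.le_dist hY y)
      rw [← e₁]
      exact hY.isAxial_of_forall_le fun z ↦ e₁ ▸ hq.le_dist hY z
    obtain ⟨τ, hτ⟩ := IsAxial.exists_axis_eq hY h4 hl hy hq
    exact ⟨!₂[τ, s], by simp [e, hτ]⟩

end StewartSpace

lemma ProperlyDisc.not_forall_int {G X : Type*} [Group G] [MetricSpace X] {φ : G →* (X ≃ᵢ X)}
    (hφ : ProperlyDisc φ) {K : Set X} (hK : IsCompact K) {k : ℤ → G}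
    (hk : Function.Injective k) : ∃ n, ¬ (φ (k n) '' K ∩ K).Nonempty := by
  by_contra! h
  exact infinite_range_of_injective hk ((hφ K hK).subset (by rintro _ ⟨n, rfl⟩; exact h n))

/-- The element of a free abelian group of rank two with given coordinates. -/
def ofCoords {A : Type*} [Group A] (iso : A ≃* Multiplicative (ℤ × ℤ)) (m n : ℤ) : A :=
  iso.symm (Multiplicative.ofAdd (m, n))

section OfCoords

variable {A : Type*} [Group A] (iso : A ≃* Multiplicative (ℤ × ℤ))

lemma ofCoords_eq (m n : ℤ) : ofCoords iso m n = ofCoords iso 1 0 ^ m * ofCoords iso 0 1 ^ n := by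
  simp only [ofCoords, ← map_zpow, ← map_mul, ← ofAdd_zsmul, ← ofAdd_add]
  simp

lemma exists_ofCoords_eq (g : A) : ∃ m n, ofCoords iso m n = g :=
  ⟨(iso g).toAdd.1, (iso g).toAdd.2, by simp [ofCoords]⟩

lemma ofCoords_inj {m n m' n' : ℤ} (h : ofCoords iso m n = ofCoords iso m' n') :
    m = m' ∧ n = n' := by
  simpa [ofCoords] using h

lemma commute_ofCoords (m n m' n' : ℤ) : Commute (ofCoords iso m n) (ofCoords iso m' n') := by
  simp only [Commute, SemiconjBy, ofCoords, ← map_mul, mul_comm]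

lemma map_ofCoords_apply {X T : Type*} [MetricSpace X] [AddCommGroup T] {φ : A →* (X ≃ᵢ X)}
    {c : T → X} {v w : T} (hv : ∀ t, φ (ofCoords iso 1 0) (c t) = c (t + v))
    (hw : ∀ t, φ (ofCoords iso 0 1) (c t) = c (t + w)) (m n : ℤ) (t : T) :
    φ (ofCoords iso m n) (c t) = c (t + (m • v + n • w)) := by
  rw [ofCoords_eq, map_mul, map_zpow, map_zpow, IsometryEquiv.mul_apply,
    zpow_apply_of_translation hw, zpow_apply_of_translation hv]
  congr 1
  abel

/-- A free abelian group of rank two which acts properly discontinuously cannot act by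
translations on a line. -/
lemma ProperlyDisc.not_isometry_line {X : Type*} [MetricSpace X] {φ : A →* (X ≃ᵢ X)}
    (hφ : ProperlyDisc φ) {c : ℝ → X} (hc : Isometry c) {ℓ β : ℝ} (hℓ : 0 < ℓ)
    (h₁ : ∀ t, φ (ofCoords iso 1 0) (c t) = c (t + ℓ)) :
    ¬ ∀ t, φ (ofCoords iso 0 1) (c t) = c (t + β) := by
  intro h₂
  obtain ⟨n, hn⟩ := hφ.not_forall_int (isCompact_Icc (a := (0 : ℝ)) (b := ℓ) |>.image hc.continuous)
    (k := fun n ↦ ofCoords iso (-⌊n * β / ℓ⌋) n) (fun m n h ↦ (ofCoords_inj iso h).2)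
  refine hn ⟨_, mem_image_of_mem _ (mem_image_of_mem c ⟨le_rfl, hℓ.le⟩), ?_⟩
  rw [map_ofCoords_apply iso h₁ h₂]
  refine mem_image_of_mem c ?_
  have e : 0 + ((-⌊(n : ℝ) * β / ℓ⌋) • ℓ + n • β) = Int.fract (n * β / ℓ) * ℓ := by
    rw [Int.fract, sub_mul, div_mul_cancel₀ _ hℓ.ne']
    simp only [zsmul_eq_mul, Int.cast_neg]
    ring
  rw [e]
  exact ⟨mul_nonneg (Int.fract_nonneg _) hℓ.le,
    mul_le_of_le_one_left hℓ.le (Int.fract_lt_one _).le⟩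

lemma ProperlyDisc.transLen_pos {X : Type*} [MetricSpace X] {φ : A →* (X ≃ᵢ X)}
    (hφ : ProperlyDisc φ) (hs : SemiSimple (φ (ofCoords iso 1 0))) :
    0 < transLen (φ (ofCoords iso 1 0)) := by
  obtain ⟨x, hx⟩ := hs
  refine lt_of_le_of_ne (hx ▸ dist_nonneg) fun h0 ↦ ?_
  have hfix := dist_eq_zero.1 (hx.trans h0.symm)
  obtain ⟨n, hn⟩ := hφ.not_forall_int (isCompact_singleton (x := x))
    (k := fun n ↦ ofCoords iso n 0) (fun m n h ↦ (ofCoords_inj iso h).1)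
  refine hn ⟨x, ⟨x, rfl, ?_⟩, rfl⟩
  rw [ofCoords_eq, zpow_zero, mul_one, map_zpow]
  exact zpow_apply_of_translation (c := fun _ : ℤ ↦ x) (v := 0) (fun _ ↦ hfix.symm) n 0

end OfCoords

/-- Every vector of the plane is a combination of the vectors `(0, ℓ)` and `(l, β)`. -/
lemma exists_eq_smul_add_smul {l ℓ : ℝ} (hl : l ≠ 0) (hℓ : ℓ ≠ 0) (β : ℝ)
    (p : EuclideanSpace ℝ (Fin 2)) :
    ∃ s t : ℝ, p = s • !₂[0, ℓ] + t • !₂[l, β] := by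
  refine ⟨(p 1 - p 0 / l * β) / ℓ, p 0 / l, ?_⟩
  ext i
  fin_cases i <;> simp <;> field_simp
  ring

/-- A convex set containing a translate of a lattice is everything. -/
lemma Convex.eq_univ_of_lattice {V : Type*} [AddCommGroup V] [Module ℝ V] {C : Set V}
    (hC : Convex ℝ C) {v w y : V} (hvw : ∀ p : V, ∃ s t : ℝ, p = s • v + t • w)
    (hy : ∀ m n : ℤ, y + (m • v + n • w) ∈ C) : C = univ := by
  refine eq_univ_of_forall fun p ↦ ?_
  obtain ⟨s, t, hst⟩ := hvw (p - y)
  have hs₀ := Int.fract_nonneg s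
  have hs₁ := sub_nonneg.2 (Int.fract_lt_one s).le
  have ht₀ := Int.fract_nonneg t
  have ht₁ := sub_nonneg.2 (Int.fract_lt_one t).le
  have h₁ := hC (hy ⌊s⌋ ⌊t⌋) (hy (⌊s⌋ + 1) ⌊t⌋) hs₁ hs₀ (by ring)
  have h₂ := hC (hy ⌊s⌋ (⌊t⌋ + 1)) (hy (⌊s⌋ + 1) (⌊t⌋ + 1)) hs₁ hs₀ (by ring)
  have h₃ := hC h₁ h₂ ht₁ ht₀ (by ring)
  convert h₃ using 1
  rw [sub_eq_iff_eq_add.1 hst]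
  simp only [← Int.cast_smul_eq_zsmul ℝ, Int.fract, Int.cast_add, Int.cast_one]
  module

/-- An isometric embedding between spaces of the same dimension is surjective. -/
lemma Isometry.surjective_of_finiteDimensional {V : Type*} [NormedAddCommGroup V]
    [NormedSpace ℝ V] [StrictConvexSpace ℝ V] [FiniteDimensional ℝ V] {k : V → V}
    (hk : Isometry k) : Function.Surjective k := by
  have h : Function.Surjective hk.affineIsometryOfStrictConvexSpace.linearIsometry :=
    LinearMap.injective_iff_surjective (f :=
      hk.affineIsometryOfStrictConvexSpace.linearIsometry.toLinearMap).1
      hk.affineIsometryOfStrictConvexSpace.linearIsometry.injective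
  intro p
  obtain ⟨q, hq⟩ := h (p - k 0)
  refine ⟨q, ?_⟩
  have := hk.affineIsometryOfStrictConvexSpace.map_vadd 0 q
  simp only [vadd_eq_add, add_zero, hq] at this
  simpa using this

/-- Flat torus theorem in dimension 2: if a free abelian group of rank 2
acts properly discontinuously by semi-simple isometries on a CAT(0) space of covering
dimension ≤ 2, then `⋂ₐ Min(a)` is an isometrically embedded Euclidean plane, invariant,
on which the group acts cocompactly by translations, and it is the unique invariant
subset isometric to the Euclidean plane. -/
theorem flat_torus_dim2
    (A : Type*) [Group A] (iso : A ≃* Multiplicative (ℤ × ℤ))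
    (X : Type*) [MetricSpace X] (hX : IsCAT0 X) (hdim : CovDimLE X 2)
    (φ : A →* (X ≃ᵢ X)) (hpd : ProperlyDisc φ) (hss : ∀ g : A, SemiSimple ⇑(φ g)) :
    let P : Set X := ⋂ a : A, MinSet ⇑(φ a)
    (∃ e : EuclideanSpace ℝ (Fin 2) → X, Isometry e ∧ Set.range e = P ∧
       ∀ a : A, ∃ v : EuclideanSpace ℝ (Fin 2), ∀ p, φ a (e p) = e (p + v)) ∧
    (∀ a : A, ⇑(φ a) '' P = P) ∧
    (∃ K : Set X, IsCompact K ∧ K ⊆ P ∧ ⋃ a : A, ⇑(φ a) '' K = P) ∧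
    (∀ S : Set X, (∀ a : A, ⇑(φ a) '' S = S) →
       (∃ f : EuclideanSpace ℝ (Fin 2) → X, Isometry f ∧ Set.range f = S) → S = P) := by
  intro P
  have hZ := hX.stewartSpace
  set a := ofCoords iso 1 0 with ha
  set b := ofCoords iso 0 1 with hb
  have hℓ := hpd.transLen_pos iso (hss a)
  obtain ⟨x₀, hx₀⟩ := hss a
  have hab : Commute (φ b) (φ a) := (commute_ofCoords iso 0 1 1 0).map φ
  rcases hZ.exists_line_or_plane hdim hab hℓ (hZ.isAxial_iff_mem_minSet.2 hx₀) with
    ⟨c, β, hc, hca, hcb⟩ | ⟨e, l, β, hl, he, hea, heb, hmin⟩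
  · exact absurd hcb (hpd.not_isometry_line iso hc hℓ hca)
  have hspan := exists_eq_smul_add_smul hl.ne' hℓ.ne' β
  generalize hv : (!₂[0, transLen (φ a)] : EuclideanSpace ℝ (Fin 2)) = v at hea hspan
  generalize hw : (!₂[l, β] : EuclideanSpace ℝ (Fin 2)) = w at heb hspan
  have hmap := map_ofCoords_apply iso hea heb
  have htrans : ∀ g, ∃ u, ∀ p, φ g (e p) = e (p + u) := fun g ↦ by
    obtain ⟨m, n, rfl⟩ := exists_ofCoords_eq iso g
    exact ⟨_, hmap m n⟩
  have hP : range e = P := by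
    refine subset_antisymm ?_ fun x hx ↦ hmin x (mem_iInter.1 hx a) (mem_iInter.1 hx b)
    rintro _ ⟨p, rfl⟩
    refine mem_iInter.2 fun g ↦ ?_
    obtain ⟨u, hu⟩ := htrans g
    have hax : StewartSpace.IsAxial (φ g) ‖u‖ (e p) := by
      refine ⟨by rw [hu, he.dist_eq, dist_self_add_right], ?_⟩
      rw [hu, hu, he.dist_eq, add_assoc, dist_self_add_right, ← two_smul ℝ u, norm_smul]
      norm_num
    rw [← hZ.isAxial_iff_mem_minSet, hax.transLen_eq hZ]
    exact hax
  have hinv : ∀ g, φ g '' P = P := fun g ↦ by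
    obtain ⟨u, hu⟩ := htrans g
    rw [← hP]
    refine subset_antisymm ?_ ?_
    · rintro _ ⟨_, ⟨p, rfl⟩, rfl⟩
      exact ⟨p + u, (hu p).symm⟩
    · rintro _ ⟨p, rfl⟩
      exact ⟨e (p - u), mem_range_self _, by rw [hu, sub_add_cancel]⟩
  refine ⟨⟨e, he, hP, htrans⟩, hinv, ?_, ?_⟩
  · refine ⟨(fun q : ℝ × ℝ ↦ e (q.1 • v + q.2 • w)) '' (Icc 0 1 ×ˢ Icc 0 1),
      (isCompact_Icc.prod isCompact_Icc).image (he.continuous.comp (by fun_prop)), ?_, ?_⟩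
    · rw [← hP]
      rintro _ ⟨q, -, rfl⟩
      exact mem_range_self _
    · refine subset_antisymm (iUnion_subset fun g ↦ ?_) ?_
      · rw [← hinv g, ← hP]
        refine image_mono ?_
        rintro _ ⟨q, -, rfl⟩
        exact mem_range_self _
      · rw [← hP]
        rintro _ ⟨p, rfl⟩
        obtain ⟨s, t, rfl⟩ := hspan p
        refine mem_iUnion.2 ⟨ofCoords iso ⌊s⌋ ⌊t⌋, _, ⟨(Int.fract s, Int.fract t),
          ⟨⟨Int.fract_nonneg _, (Int.fract_lt_one _).le⟩,
            ⟨Int.fract_nonneg _, (Int.fract_lt_one _).le⟩⟩, rfl⟩, ?_⟩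
        rw [hmap]
        simp only [← Int.cast_smul_eq_zsmul ℝ, Int.fract]
        congr 1
        module
  · rintro S hS ⟨f, hf, rfl⟩
    obtain ⟨y, hyf, hy⟩ := hZ.exists_dist_map_le hf (e 0)
    have hyP : y ∈ P := mem_iInter.2 fun g ↦ by
      have h0 : dist (e 0) (φ g (e 0)) = transLen (φ g) :=
        mem_iInter.1 (hP ▸ mem_range_self (0 : EuclideanSpace ℝ (Fin 2)) : e 0 ∈ P) g
      exact le_antisymm (h0 ▸ hy (φ g) (hS g))
        (csInf_le ⟨0, by rintro _ ⟨z, rfl⟩; exact dist_nonneg⟩ (mem_range_self y))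
    obtain ⟨p, rfl⟩ := hP.symm ▸ hyP
    have hconv : Convex ℝ (e ⁻¹' range f) := by
      rw [convex_iff_segment_subset]
      rintro q ⟨q', hq⟩ r ⟨r', hr⟩ z hz
      rw [segment_eq_image_lineMap] at hz
      obtain ⟨t, ht, rfl⟩ := hz
      refine ⟨AffineMap.lineMap q' r' t, ?_⟩
      rw [hf.map_lineMap hZ _ _ ht, he.map_lineMap hZ _ _ ht, hq, hr]
    have huniv := hconv.eq_univ_of_lattice hspan (y := p) fun m n ↦ by
      rw [mem_preimage, ← hmap, ← hS]
      exact mem_image_of_mem _ hyf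
    choose k hk using fun q ↦ (huniv ▸ mem_univ q : q ∈ e ⁻¹' range f)
    have hki : Isometry k := Isometry.of_dist_eq fun q r ↦ by
      rw [← hf.dist_eq, hk, hk, he.dist_eq]
    rw [← hP]
    refine subset_antisymm ?_ ?_
    · rintro _ ⟨q, rfl⟩
      obtain ⟨r, rfl⟩ := hki.surjective_of_finiteDimensional q
      exact ⟨r, (hk r).symm⟩
    · rintro _ ⟨q, rfl⟩
      exact ⟨k q, hk q⟩
end

section
/- Let m ≥ 3 be odd and let A(m) be the dihedral-type Artin group with Artin generators a, b, and let Δ = (a,b)_m. Then the element Δ² has infinite order in A(m) and the center of A(m) is exactly the cyclic subgroup generated by Δ²; i.e. Subgroup.center A(m) = Subgroup.zpowers (Δ²). -/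
namespace Monoid.CoprodI

variable {ι : Type*} {G : ι → Type*} [∀ i, Group (G i)]

open Classical in
theorem Word.length_smul_le_of_fstIdx_eq {i : ι} (y : G i) (w : Word G)
    (h : w.fstIdx = some i) : (y • w).toList.length ≤ w.toList.length := by
  induction w using Word.consRecOn with
  | empty => simp [Word.fstIdx] at h
  | cons j x w h₁ h₂ _ =>
    obtain rfl : j = i := by simpa using h
    have hsmul : y • Word.cons x w h₁ h₂ = Word.rcons ⟨y * x, w, h₁⟩ := by
      rw [Word.cons_eq_smul, Word.rcons_eq_smul, Word.smul_eq_of_smul, smul_smul, ← map_mul]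
    rw [hsmul, Word.rcons]
    split_ifs <;> simp

theorem Word.prod_injective : Function.Injective (Word.prod : Word G → CoprodI G) := by
  classical exact Word.equiv.symm.injective

theorem NeWord.toList_eq_of_prod_eq {i j k l : ι} {v : NeWord G i j} {w : NeWord G k l}
    (h : v.prod = w.prod) : v.toList = w.toList :=
  congrArg Word.toList (Word.prod_injective h)

theorem NeWord.fst_eq_of_prod_eq {i j k l : ι} {v : NeWord G i j} {w : NeWord G k l}
    (h : v.prod = w.prod) : i = k := by
  have hhead := congrArg List.head? (NeWord.toList_eq_of_prod_eq h)
  rw [NeWord.toList_head?, NeWord.toList_head?] at hhead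
  exact congrArg Sigma.fst (Option.some.inj hhead)

/-- In a free product of at least two groups, only the identity commutes with a nontrivial
element of each factor. -/
theorem eq_one_of_commute_of [Nontrivial ι] {y : ∀ i, G i} (hy : ∀ i, y i ≠ 1) {z : CoprodI G}
    (hz : ∀ i, Commute z (of (y i))) : z = 1 := by
  classical
  by_contra hne
  have hword : Word.equiv z ≠ Word.empty := fun h => hne <| by
    simpa [Word.equiv] using congrArg Word.equiv.symm h
  obtain ⟨i, j, w, hw⟩ := NeWord.of_word _ hword
  obtain rfl : w.prod = z := by
    rw [NeWord.prod, hw]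
    exact Word.equiv.symm_apply_apply z
  by_cases hij : i = j
  · subst hij
    obtain ⟨k, hk⟩ := exists_ne i
    refine hk.symm (NeWord.fst_eq_of_prod_eq (v := w.append hk.symm (.singleton (y k) (hy k)))
      (w := (NeWord.singleton (y k) (hy k)).append hk w) ?_)
    simpa using (hz k).eq
  · have hji : j ≠ i := Ne.symm hij
    have hprod : (w.append hji (.singleton (y i) (hy i))).toWord = y i • w.toWord := by
      apply Word.prod_injective
      rw [Word.smul_eq_of_smul, Word.prod_smul]
      change (w.append hji (.singleton (y i) (hy i))).prod = of (y i) * w.prod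
      simpa using (hz i).eq
    have hlen := Word.length_smul_le_of_fstIdx_eq (y i) w.toWord (by
      simp [Word.fstIdx, NeWord.toWord])
    rw [← hprod] at hlen
    simp [NeWord.toWord] at hlen

end Monoid.CoprodI

theorem exists_hom_multiplicative_zmod {Q : Type*} [Group Q] {n : ℕ} {q : Q} (hq : q ^ n = 1) :
    ∃ f : Multiplicative (ZMod n) →* Q, f (.ofAdd 1) = q := by
  refine ⟨AddMonoidHom.toMultiplicativeLeft
    (ZMod.lift n ⟨zmultiplesHom (Additive Q) (.ofMul q), ?_⟩), ?_⟩
  · simp [← ofMul_pow, hq]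
  · have h := ZMod.lift_coe n (A := Additive Q)
      ⟨zmultiplesHom (Additive Q) (.ofMul q), by simp [← ofMul_pow, hq]⟩ 1
    simp only [Int.cast_one] at h
    simp [h]

section AltProd

theorem altProd_two_mul_add_one {G : Type*} [Monoid G] (x y : G) (k : ℕ) :
    altProd x y (2 * k + 1) = (x * y) ^ k * x := by
  induction k with
  | zero => simp [altProd]
  | succ k ih =>
    rw [show 2 * (k + 1) + 1 = (2 * k + 1) + 1 + 1 by ring]
    change x * (y * altProd x y (2 * k + 1)) = _
    rw [ih, pow_succ']
    simp only [mul_assoc]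

theorem map_altProd {G H : Type*} [Monoid G] [Monoid H] (f : G →* H) (x y : G) (k : ℕ) :
    f (altProd x y k) = altProd (f x) (f y) k := by
  induction k generalizing x y with
  | zero => simp [altProd]
  | succ k ih => simp [altProd, ih]

variable {G : Type*} [Group G] {x y : G} {k : ℕ}

theorem altProd_sq (h : altProd x y (2 * k + 1) = altProd y x (2 * k + 1)) :
    altProd x y (2 * k + 1) ^ 2 = (x * y) ^ (2 * k + 1) := by
  have hyx : altProd y x (2 * k + 1) = y * (x * y) ^ k := by
    rw [altProd_two_mul_add_one, mul_pow_mul]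
  rw [sq]
  nth_rewrite 2 [h]
  rw [hyx, altProd_two_mul_add_one, show 2 * k + 1 = k + 1 + k by ring, pow_add, pow_succ]
  simp only [mul_assoc]

theorem commute_altProd_sq_left (h : altProd x y (2 * k + 1) = altProd y x (2 * k + 1)) :
    Commute (altProd x y (2 * k + 1) ^ 2) x := by
  have hx : SemiconjBy (altProd x y (2 * k + 1)) x y := by
    have : altProd x y (2 * k + 1) = y * (x * y) ^ k := by
      rw [h, altProd_two_mul_add_one, mul_pow_mul]
    unfold SemiconjBy
    nth_rewrite 1 [this]
    rw [altProd_two_mul_add_one]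
    simp only [mul_assoc]
  have hy : SemiconjBy (altProd x y (2 * k + 1)) y x := by
    have : altProd x y (2 * k + 1) = y * (x * y) ^ k := by
      rw [h, altProd_two_mul_add_one, mul_pow_mul]
    unfold SemiconjBy
    nth_rewrite 2 [this]
    rw [altProd_two_mul_add_one, mul_assoc, ← pow_succ, pow_succ', mul_assoc]
  rw [sq]
  exact hy.mul_left hx

end AltProd

namespace PresentedGroup

variable {m k : ℕ}

theorem altProd_of_dihedralRel (m : ℕ) :
    altProd (of 0 : PresentedGroup (dihedralRel m)) (of 1) m = altProd (of 1) (of 0) m := by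
  have h := one_of_mem (rels := dihedralRel m) (Set.mem_singleton _)
  rw [map_mul, map_inv, mul_inv_eq_one, map_altProd, map_altProd] at h
  exact h

/-- The homomorphism out of `A(m)` given by two elements satisfying the Artin relation. -/
def dihedralLift {H : Type*} [Group H] (x y : H) (h : altProd x y m = altProd y x m) :
    PresentedGroup (dihedralRel m) →* H :=
  toGroup (f := ![x, y]) <| by
    rintro r rfl
    simp [map_altProd, h]

section Lift

variable {H : Type*} [Group H] {x y : H} (h : altProd x y m = altProd y x m)

@[simp]
theorem dihedralLift_of_zero : dihedralLift x y h (of 0) = x := toGroup.of _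

@[simp]
theorem dihedralLift_of_one : dihedralLift x y h (of 1) = y := toGroup.of _

end Lift

theorem dihedral_hom_ext {H : Type*} [Group H] {f g : PresentedGroup (dihedralRel m) →* H}
    (h₀ : f (of 0) = g (of 0)) (h₁ : f (of 1) = g (of 1)) : f = g := by
  ext i
  fin_cases i
  exacts [h₀, h₁]

theorem not_isOfFinOrder_altProd_sq (hm : m ≠ 0) :
    ¬ IsOfFinOrder (altProd (of 0 : PresentedGroup (dihedralRel m)) (of 1) m ^ 2) := by
  intro hfin
  have haltProd : ∀ n : ℕ, altProd (Multiplicative.ofAdd (1 : ℤ)) (.ofAdd 1) n = .ofAdd (n : ℤ) := by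
    intro n
    induction n with
    | zero => rfl
    | succ n ih =>
      rw [altProd, ih, ← ofAdd_add]
      congr 1
      push_cast
      ring
  have himage := (dihedralLift (m := m) (Multiplicative.ofAdd (1 : ℤ)) (.ofAdd 1) rfl).isOfFinOrder
    hfin
  rw [map_pow, map_altProd, dihedralLift_of_zero, dihedralLift_of_one, haltProd,
    isOfFinOrder_iff_eq_one, ← ofAdd_nsmul, ofAdd_eq_one] at himage
  simp [hm] at himage

theorem altProd_sq_mem_center (k : ℕ) :
    altProd (of 0 : PresentedGroup (dihedralRel (2 * k + 1))) (of 1) (2 * k + 1) ^ 2 ∈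
      Subgroup.center _ := by
  have hrel := altProd_of_dihedralRel (2 * k + 1)
  rw [← Subgroup.centralizer_univ, ← Subgroup.coe_top, ← closure_range_of,
    Subgroup.centralizer_closure, Subgroup.mem_centralizer_iff]
  rintro _ ⟨i, rfl⟩
  fin_cases i
  · exact (commute_altProd_sq_left hrel).symm
  · rw [hrel]
    exact (commute_altProd_sq_left hrel.symm).symm

open Monoid in
theorem center_le_zpowers_altProd_sq (hk : k ≠ 0) :
    Subgroup.center (PresentedGroup (dihedralRel (2 * k + 1))) ≤
      Subgroup.zpowers (altProd (of 0) (of 1) (2 * k + 1) ^ 2) := by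
  set A := PresentedGroup (dihedralRel (2 * k + 1))
  set Δ : A := altProd (of 0) (of 1) (2 * k + 1) with hΔ
  have hrel : Δ = altProd (of 1) (of 0) (2 * k + 1) := altProd_of_dihedralRel _
  have hnormal : (Subgroup.zpowers (Δ ^ 2)).Normal :=
    ⟨fun g hg c => by
      have hcenter := Subgroup.zpowers_le.mpr (altProd_sq_mem_center k) hg
      rwa [Subgroup.mem_center_iff.mp hcenter c, mul_inv_cancel_right]⟩
  let n : Bool → ℕ := fun i => cond i 2 (2 * k + 1)
  let F := CoprodI fun i => Multiplicative (ZMod (n i))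
  let gen (i : Bool) : Multiplicative (ZMod (n i)) := .ofAdd 1
  let s : F := CoprodI.of (gen true)
  let t : F := CoprodI.of (gen false)
  have hgen (i : Bool) : gen i ^ n i = 1 := by
    rw [← ofAdd_nsmul]
    simp
  have hs : s * s = 1 := by
    rw [← sq, ← map_pow, show gen true ^ 2 = 1 from hgen true, map_one]
  have ht : t ^ (2 * k + 1) = 1 := by
    rw [← map_pow, show gen false ^ (2 * k + 1) = 1 from hgen false, map_one]
  have ht' : (t ^ k)⁻¹ * (t ^ k)⁻¹ = t := by
    rw [← mul_inv_rev, inv_eq_iff_mul_eq_one, ← pow_add, ← pow_succ, ← two_mul, ht]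
  let x : F := (t ^ k)⁻¹ * s
  let y : F := s * (t ^ k)⁻¹
  have hxy : x * y = t := by
    calc x * y = (t ^ k)⁻¹ * (s * s) * (t ^ k)⁻¹ := by simp only [x, y, mul_assoc]
      _ = t := by rw [hs, mul_one, ht']
  have halt : altProd x y (2 * k + 1) = s := by
    rw [altProd_two_mul_add_one, hxy, mul_inv_cancel_left]
  have halt' : altProd y x (2 * k + 1) = s := by
    rw [altProd_two_mul_add_one, mul_pow_mul, hxy, inv_mul_cancel_right]
  obtain ⟨φ, hφ₀, hφ₁⟩ : ∃ φ : A →* F, φ (of 0) = x ∧ φ (of 1) = y :=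
    ⟨dihedralLift x y (halt.trans halt'.symm), dihedralLift_of_zero _, dihedralLift_of_one _⟩
  have hφs : φ Δ = s := by rw [hΔ, map_altProd, hφ₀, hφ₁, halt]
  have hφt : φ (of 0 * of 1) = t := by rw [map_mul, hφ₀, hφ₁, hxy]
  let π := QuotientGroup.mk' (Subgroup.zpowers (Δ ^ 2))
  have hΔone : π Δ ^ 2 = 1 := by
    rw [← map_pow]
    exact (QuotientGroup.eq_one_iff _).mpr (Subgroup.mem_zpowers _)
  have hlift : ∀ i, ∃ f : Multiplicative (ZMod (n i)) →* A ⧸ Subgroup.zpowers (Δ ^ 2),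
      f (gen i) = cond i (π Δ) (π (of 0 * of 1)) := by
    intro i
    apply exists_hom_multiplicative_zmod
    cases i
    · change π (of 0 * of 1) ^ (2 * k + 1) = 1
      rw [← map_pow, ← altProd_sq hrel, map_pow]
      exact hΔone
    · exact hΔone
  choose f hf using hlift
  let ψ := CoprodI.lift f
  have hψs : ψ s = π Δ := (CoprodI.lift_of f _).trans (hf true)
  have hψt : ψ t = π (of 0 * of 1) := (CoprodI.lift_of f _).trans (hf false)
  have hψφ : ψ.comp φ = π := by
    apply dihedral_hom_ext
    · simp only [MonoidHom.comp_apply, hφ₀, x, map_mul, map_inv, map_pow,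
        hψs, hψt]
      simp only [← map_mul, ← map_inv, ← map_pow, hΔ, altProd_two_mul_add_one,
        inv_mul_cancel_left]
    · simp only [MonoidHom.comp_apply, hφ₁, y, map_mul, map_inv, map_pow,
        hψs, hψt]
      simp only [← map_mul, ← map_inv, ← map_pow]
      congr 1
      rw [hrel, altProd_two_mul_add_one, mul_pow_mul, mul_inv_cancel_right]
  have hgen_ne (i : Bool) : gen i ≠ 1 := by
    have : Fact (1 < n i) := ⟨by cases i <;> simp [n]; omega⟩
    simp [gen]
  intro z hz
  have hφz : φ z = 1 := by
    refine CoprodI.eq_one_of_commute_of hgen_ne fun i => ?_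
    have hcomm (g : A) : Commute (φ z) (φ g) :=
      (show Commute z g from (Subgroup.mem_center_iff.mp hz g).symm).map φ
    cases i
    · have h := hcomm (of 0 * of 1)
      rwa [hφt] at h
    · have h := hcomm Δ
      rwa [hφs] at h
  rw [← QuotientGroup.eq_one_iff]
  change π z = 1
  rw [← hψφ, MonoidHom.comp_apply, hφz, map_one]

end PresentedGroup

/-- For odd `m ≥ 3`, the element `Δ²` (where `Δ = (a,b)_m`) has infinite
order in the dihedral-type Artin group `A(m)` and generates its centre. -/
theorem dihedral_artin_center_odd (m : ℕ) (hm : 3 ≤ m) (hodd : Odd m) :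
    let a : PresentedGroup (dihedralRel m) := PresentedGroup.of 0
    let b : PresentedGroup (dihedralRel m) := PresentedGroup.of 1
    let Δ := altProd a b m
    ¬ IsOfFinOrder (Δ ^ 2) ∧
    Subgroup.center (PresentedGroup (dihedralRel m)) = Subgroup.zpowers (Δ ^ 2) := by
  intro a b Δ
  obtain ⟨k, rfl⟩ := hodd
  exact ⟨PresentedGroup.not_isOfFinOrder_altProd_sq (by omega),
    (PresentedGroup.center_le_zpowers_altProd_sq (by omega)).antisymm
      (Subgroup.zpowers_le.mpr (PresentedGroup.altProd_sq_mem_center k))⟩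
end

section
/- Let m ≥ 4 be even, let A(m) be the dihedral-type Artin group with Artin generators a, b, and let Δ = (a,b)_m. Then Δ has infinite order, the center of A(m) is exactly the cyclic subgroup generated by Δ (i.e. Subgroup.center A(m) = Subgroup.zpowers Δ), and the quotient A(m)/⟨Δ⟩ is isomorphic to the free product ℤ * (ℤ/(m/2)), via an isomorphism sending the image of a to a generator of the ℤ factor and the image of ab to a generator of the ℤ/(m/2) factor. -/
namespace Monoid.CoprodI

variable {ι : Type*} {G : ι → Type*} [∀ i, Group (G i)]

/-- A free product of at least two nontrivial groups has trivial centre. -/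
theorem center_eq_bot [Nontrivial ι] [∀ i, Nontrivial (G i)] :
    Subgroup.center (CoprodI G) = ⊥ := by
  classical
  rw [eq_bot_iff]
  intro z hz
  rw [Subgroup.mem_bot]
  by_contra hne
  obtain ⟨w, rfl⟩ : ∃ w : Word G, w.prod = z := Word.equiv.symm.surjective z
  obtain ⟨i, j, w, rfl⟩ := NeWord.of_word w (by rintro rfl; exact hne Word.prod_empty)
  obtain ⟨k, hk⟩ := exists_ne j
  obtain ⟨g, hg⟩ := exists_ne (1 : G k)
  let u : NeWord G k k := NeWord.singleton g hg
  let v : NeWord G i i := (w.append hk.symm u).append hk w.inv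
  have hprod : v.prod = u.prod := by
    have hcomm : u.prod * w.prod = w.prod * u.prod := Subgroup.mem_center_iff.mp hz _
    simp only [v, NeWord.append_prod, NeWord.inv_prod]
    rw [← hcomm, mul_inv_cancel_right]
  have hword : v.toWord = u.toWord := Word.equiv.symm.injective hprod
  have hlen : v.toList.length = u.toList.length := congrArg (fun x => x.toList.length) hword
  have hw := List.length_pos_iff.mpr w.toList_ne_nil
  simp only [v, u, NeWord.toList, List.length_append, List.length_singleton] at hlen
  omega

end Monoid.CoprodI

namespace Monoid.Coprod

/-- The binary free product as an indexed free product over `Bool`. -/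
def equivCoprodI (G : Bool → Type*) [∀ b, Group (G b)] :
    Coprod (G true) (G false) ≃* CoprodI G :=
  MonoidHom.toMulEquiv (lift CoprodI.of CoprodI.of)
    (CoprodI.lift fun b => match b with
      | true => inl
      | false => inr)
    (by ext x <;> simp)
    (by ext b x; cases b <;> simp)

universe u v

/-- The free product of two nontrivial groups has trivial centre. -/
theorem center_eq_bot (G : Type u) (H : Type v) [Group G] [Group H] [Nontrivial G] [Nontrivial H] :
    Subgroup.center (Coprod G H) = ⊥ := by
  let F : Bool → Type _ := fun b => cond b (ULift.{max u v} G) (ULift.{max u v} H)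
  let : ∀ b, Group (F b)
    | true => ULift.group
    | false => ULift.group
  have : ∀ b, Nontrivial (F b)
    | true => ULift.nontrivial
    | false => ULift.nontrivial
  let e : Coprod G H ≃* CoprodI F :=
    (MulEquiv.coprodCongr MulEquiv.ulift.symm MulEquiv.ulift.symm).trans (equivCoprodI F)
  rw [eq_bot_iff]
  intro z hz
  have hez : e z ∈ Subgroup.center (CoprodI F) := by
    rw [Subgroup.mem_center_iff] at hz ⊢
    intro g
    obtain ⟨g, rfl⟩ := e.surjective g
    rw [← map_mul, ← map_mul, hz]
  rw [CoprodI.center_eq_bot, Subgroup.mem_bot] at hez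
  exact Subgroup.mem_bot.mpr ((map_eq_one_iff e e.injective).mp hez)

end Monoid.Coprod

theorem altProd_two_mul {G : Type*} [Monoid G] (x y : G) (n : ℕ) :
    altProd x y (2 * n) = (x * y) ^ n := by
  induction n with
  | zero => simp [altProd]
  | succ n ih =>
    rw [show 2 * (n + 1) = 2 * n + 1 + 1 by ring]
    simp only [altProd]
    rw [ih, pow_succ', mul_assoc]

namespace DihedralArtin

variable {m : ℕ}

theorem altProd_comm :
    altProd (PresentedGroup.of 0 : PresentedGroup (dihedralRel m)) (PresentedGroup.of 1) m =
      altProd (PresentedGroup.of 1) (PresentedGroup.of 0) m := by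
  have h := PresentedGroup.one_of_mem (rels := dihedralRel m) rfl
  rw [map_mul, map_inv, mul_inv_eq_one, map_altProd, map_altProd] at h
  exact h

/-- The homomorphism out of `A(m)` given by two elements satisfying the braid relation. -/
def lift {G : Type*} [Group G] (x y : G) (h : altProd x y m = altProd y x m) :
    PresentedGroup (dihedralRel m) →* G :=
  PresentedGroup.toGroup (f := ![x, y]) (by
    rintro r rfl
    simp [map_altProd, h])

section lift

variable {G : Type*} [Group G] {x y : G} (h : altProd x y m = altProd y x m)

@[simp]
theorem lift_of_zero : lift x y h (PresentedGroup.of 0) = x :=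
  PresentedGroup.toGroup.of _

@[simp]
theorem lift_of_one : lift x y h (PresentedGroup.of 1) = y :=
  PresentedGroup.toGroup.of _

end lift

theorem hom_ext {G : Type*} [Group G] {f g : PresentedGroup (dihedralRel m) →* G}
    (h₀ : f (PresentedGroup.of 0) = g (PresentedGroup.of 0))
    (h₁ : f (PresentedGroup.of 1) = g (PresentedGroup.of 1)) : f = g :=
  PresentedGroup.ext fun i => by fin_cases i <;> assumption

/-- `Δ` has infinite order, since it has length `m` under the abelian length homomorphism. -/
theorem not_isOfFinOrder_altProd (hm : m ≠ 0) :
    ¬ IsOfFinOrder (altProd (PresentedGroup.of 0 : PresentedGroup (dihedralRel m))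
      (PresentedGroup.of 1) m) := by
  intro h
  have hpow : ∀ k, altProd (Multiplicative.ofAdd (1 : ℤ)) (Multiplicative.ofAdd 1) k =
      Multiplicative.ofAdd (k : ℤ) := by
    intro k
    induction k with
    | zero => rfl
    | succ k ih => rw [altProd, ih, ← ofAdd_add, Nat.cast_succ, add_comm]
  have h' := (lift (m := m) (Multiplicative.ofAdd (1 : ℤ)) (Multiplicative.ofAdd 1)
    rfl).isOfFinOrder h
  rw [map_altProd, lift_of_zero, lift_of_one, hpow, isOfFinOrder_iff_eq_one, ofAdd_eq_one] at h'
  exact hm (by exact_mod_cast h')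

theorem altProd_mem_center (heven : Even m) :
    altProd (PresentedGroup.of 0 : PresentedGroup (dihedralRel m)) (PresentedGroup.of 1) m ∈
      Subgroup.center (PresentedGroup (dihedralRel m)) := by
  obtain ⟨n, rfl⟩ := heven.exists_two_nsmul
  rw [smul_eq_mul]
  have h := altProd_comm (m := 2 * n)
  simp only [altProd_two_mul] at h ⊢
  set a : PresentedGroup (dihedralRel (2 * n)) := PresentedGroup.of 0
  set b : PresentedGroup (dihedralRel (2 * n)) := PresentedGroup.of 1
  have ha : a * (a * b) ^ n = (a * b) ^ n * a := by
    nth_rewrite 1 [h]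
    exact (SemiconjBy.pow_right (show SemiconjBy a (b * a) (a * b) from (mul_assoc a b a).symm) n)
  have hb : b * (a * b) ^ n = (a * b) ^ n * b := by
    nth_rewrite 2 [h]
    exact (SemiconjBy.pow_right (show SemiconjBy b (a * b) (b * a) from (mul_assoc b a b).symm) n)
  have hconj : MulAut.conj ((a * b) ^ n) = MulEquiv.refl _ := by
    have : (MulAut.conj ((a * b) ^ n)).toMonoidHom = MonoidHom.id _ :=
      hom_ext (mul_inv_eq_of_eq_mul ha.symm) (mul_inv_eq_of_eq_mul hb.symm)
    exact MulEquiv.toMonoidHom_injective this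
  rw [Subgroup.mem_center_iff]
  intro g
  have hg : (a * b) ^ n * g * ((a * b) ^ n)⁻¹ = g := DFunLike.congr_fun hconj g
  exact (mul_inv_eq_iff_eq_mul.mp hg).symm

open Monoid

/-- The homomorphism `A(2n) → ℤ ∗ ℤ/n` with `a ↦ inl 1` and `a * b ↦ inr 1`. -/
def toCoprod (n : ℕ) : PresentedGroup (dihedralRel (2 * n)) →*
    Coprod (Multiplicative ℤ) (Multiplicative (ZMod n)) :=
  lift (Coprod.inl (Multiplicative.ofAdd 1))
    ((Coprod.inl (Multiplicative.ofAdd 1))⁻¹ * Coprod.inr (Multiplicative.ofAdd 1)) (by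
      have hpow : (Multiplicative.ofAdd (1 : ZMod n)) ^ n = 1 := by
        rw [← ofAdd_nsmul, nsmul_one, ZMod.natCast_self, ofAdd_zero]
      set x : Coprod (Multiplicative ℤ) (Multiplicative (ZMod n)) :=
        Coprod.inl (Multiplicative.ofAdd 1)
      set y : Coprod (Multiplicative ℤ) (Multiplicative (ZMod n)) :=
        Coprod.inr (Multiplicative.ofAdd 1)
      have hy : y ^ n = 1 := by rw [← map_pow, hpow, map_one]
      have hconj : (x⁻¹ * y * x) ^ n = x⁻¹ * y ^ n * x := by
        simpa using conj_pow (i := n) (a := x⁻¹) (b := y)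
      rw [altProd_two_mul, altProd_two_mul, mul_inv_cancel_left, hconj, hy]
      simp)

variable (n : ℕ)

theorem toCoprod_of_zero :
    toCoprod n (PresentedGroup.of 0) = Coprod.inl (Multiplicative.ofAdd 1) :=
  lift_of_zero _

theorem toCoprod_mul :
    toCoprod n (PresentedGroup.of 0 * PresentedGroup.of 1) =
      Coprod.inr (Multiplicative.ofAdd 1) := by
  simp [toCoprod]

theorem toCoprod_surjective : Function.Surjective (toCoprod n) := by
  rw [← MonoidHom.range_eq_top, eq_top_iff, ← Coprod.range_inl_sup_range_inr, sup_le_iff]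
  constructor
  · rintro _ ⟨k, rfl⟩
    refine ⟨PresentedGroup.of 0 ^ k.toAdd, ?_⟩
    rw [map_zpow, toCoprod_of_zero, ← map_zpow, ← ofAdd_zsmul, zsmul_one, Int.cast_id, ofAdd_toAdd]
  · rintro _ ⟨k, rfl⟩
    obtain ⟨l, hl⟩ := ZMod.intCast_surjective k.toAdd
    refine ⟨(PresentedGroup.of 0 * PresentedGroup.of 1) ^ l, ?_⟩
    rw [map_zpow, toCoprod_mul, ← map_zpow, ← ofAdd_zsmul, zsmul_one, hl, ofAdd_toAdd]

theorem ker_toCoprod :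
    (toCoprod n).ker = Subgroup.zpowers (altProd (PresentedGroup.of 0) (PresentedGroup.of 1)
      (2 * n)) := by
  have hcenter := altProd_mem_center (m := 2 * n) (even_two_mul n)
  rw [altProd_two_mul] at hcenter ⊢
  set a : PresentedGroup (dihedralRel (2 * n)) := PresentedGroup.of 0
  set b : PresentedGroup (dihedralRel (2 * n)) := PresentedGroup.of 1
  set N := Subgroup.zpowers ((a * b) ^ n)
  have : N.Normal := ⟨fun x hx g => by
    rwa [Subgroup.mem_center_iff.mp (Subgroup.zpowers_le.mpr hcenter hx) g, mul_inv_cancel_right]⟩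
  apply le_antisymm
  · let q := QuotientGroup.mk' N
    have hq : q (a * b) ^ n = 1 := by
      rw [← map_pow]
      exact (QuotientGroup.eq_one_iff _).mpr (Subgroup.mem_zpowers _)
    let φ : {f : ℤ →+ Additive (PresentedGroup (dihedralRel (2 * n)) ⧸ N) // f n = 0} :=
      ⟨zmultiplesHom _ (Additive.ofMul (q (a * b))), by
        rw [zmultiplesHom_apply, natCast_zsmul, ← ofMul_pow, hq, ofMul_one]⟩
    let f : Multiplicative (ZMod n) →* PresentedGroup (dihedralRel (2 * n)) ⧸ N :=
      AddMonoidHom.toMultiplicativeLeft (ZMod.lift n φ)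
    have hf : f (Multiplicative.ofAdd 1) = q (a * b) := by
      have h : ZMod.lift n φ 1 = Additive.ofMul (q (a * b)) := by
        rw [← Int.cast_one, ZMod.lift_coe]
        exact one_zsmul _
      exact congrArg Additive.toMul h
    let r := Coprod.lift (zpowersHom _ (q a)) f
    have hr : r.comp (toCoprod n) = q := by
      have h₀ : r (toCoprod n a) = q a := by
        rw [toCoprod_of_zero, Coprod.lift_apply_inl, zpowersHom_apply, toAdd_ofAdd, zpow_one]
      have h₁ : r (toCoprod n (a * b)) = q (a * b) := by
        rw [toCoprod_mul, Coprod.lift_apply_inr, hf]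
      refine hom_ext h₀ ?_
      rw [map_mul, map_mul, h₀, map_mul] at h₁
      exact mul_left_cancel h₁
    intro x hx
    rw [← QuotientGroup.eq_one_iff, ← QuotientGroup.mk'_apply]
    change q x = 1
    rw [← hr, MonoidHom.comp_apply, MonoidHom.mem_ker.mp hx, map_one]
  · rw [Subgroup.zpowers_le, MonoidHom.mem_ker, map_pow, toCoprod_mul, ← map_pow, ← ofAdd_nsmul,
      nsmul_one, ZMod.natCast_self, ofAdd_zero, map_one]

theorem center_eq_zpowers (hn : 2 ≤ n) :
    Subgroup.center (PresentedGroup (dihedralRel (2 * n))) =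
      Subgroup.zpowers (altProd (PresentedGroup.of 0) (PresentedGroup.of 1) (2 * n)) := by
  apply le_antisymm
  · have : Fact (1 < n) := ⟨hn⟩
    rw [← ker_toCoprod]
    intro z hz
    rw [MonoidHom.mem_ker, ← Subgroup.mem_bot, ← Coprod.center_eq_bot, Subgroup.mem_center_iff]
    intro g
    obtain ⟨g, rfl⟩ := toCoprod_surjective n g
    rw [← map_mul, ← map_mul, Subgroup.mem_center_iff.mp hz]
  · exact Subgroup.zpowers_le.mpr (altProd_mem_center (even_two_mul n))

end DihedralArtin

/-- For even `m ≥ 4`, the element `Δ = (a,b)_m` has infinite order in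
the dihedral-type Artin group `A(m)` and generates its centre, and the quotient
`A(m)/⟨Δ⟩` is the free product `ℤ ∗ (ℤ/(m/2))`, with the image of `a` generating the `ℤ`
factor and the image of `ab` generating the `ℤ/(m/2)` factor: there is a surjective
homomorphism onto the free product with kernel exactly `⟨Δ⟩`, sending `a` and `ab` to
generators of the respective factors. -/
theorem dihedral_artin_center_even (m : ℕ) (hm : 4 ≤ m) (heven : Even m) :
    let a : PresentedGroup (dihedralRel m) := PresentedGroup.of 0
    let b : PresentedGroup (dihedralRel m) := PresentedGroup.of 1
    let Δ := altProd a b m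
    ¬ IsOfFinOrder Δ ∧
    Subgroup.center (PresentedGroup (dihedralRel m)) = Subgroup.zpowers Δ ∧
    ∃ ψ : PresentedGroup (dihedralRel m) →*
        Monoid.Coprod (Multiplicative ℤ) (Multiplicative (ZMod (m / 2))),
      Function.Surjective ψ ∧
      ψ.ker = Subgroup.zpowers Δ ∧
      ψ a = Monoid.Coprod.inl (Multiplicative.ofAdd (1 : ℤ)) ∧
      ψ (a * b) = Monoid.Coprod.inr (Multiplicative.ofAdd (1 : ZMod (m / 2))) := by
  have hm2 : m = 2 * (m / 2) := (Nat.two_mul_div_two_of_even heven).symm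
  generalize m / 2 = n at hm2 ⊢
  subst hm2
  exact ⟨DihedralArtin.not_isOfFinOrder_altProd (by omega),
    DihedralArtin.center_eq_zpowers n (by omega),
    DihedralArtin.toCoprod n, DihedralArtin.toCoprod_surjective n, DihedralArtin.ker_toCoprod n,
    DihedralArtin.toCoprod_of_zero n, DihedralArtin.toCoprod_mul n⟩
end

section
/- Let m, n ≥ 2 be integers with 1/m + 1/n + 1/2 ≤ 1, and let W(m,n,2) be the Coxeter group with generators a, b, c determined by the Coxeter matrix with off-diagonal entries M(a,b) = m, M(b,c) = n, M(a,c) = 2. Then the element a·b·c (the product of the three standard generators) has infinite order in W(m,n,2). -/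
/-- The Coxeter matrix of the `(m,n,2)` triangle group on three generators `a = 0`,
`b = 1`, `c = 2`: `M(a,b) = m`, `M(b,c) = n`, `M(a,c) = 2`. -/
def cox3 (m n : ℕ) (hm : 2 ≤ m) (hn : 2 ≤ n) : CoxeterMatrix (Fin 3) where
  M := Matrix.of ![![1, m, 2], ![m, 1, n], ![2, n, 1]]
  isSymm := by
    ext i j
    fin_cases i <;> fin_cases j <;> rfl
  diagonal := by
    intro i
    fin_cases i <;> rfl
  off_diagonal := by
    intro i j hij
    fin_cases i <;> fin_cases j <;> simp_all <;> omega

/-- The product of the reflections in the first two simple roots, in the basis of simple roots. -/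
def rotMatrix (P Q : ℝ) : Matrix (Fin 3) (Fin 3) ℝ :=
  !![P ^ 2 - 1, -P, P * Q; P, -1, Q; 0, 0, 1]

lemma sin_sq_smul_rotMatrix_pow (φ Q : ℝ) (k : ℕ) :
    (Real.sin φ) ^ 2 • rotMatrix (2 * Real.cos φ) Q ^ k =
      !![Real.sin φ * Real.sin (2 * (k * φ) + φ), -(Real.sin φ * Real.sin (2 * (k * φ))),
          Q * (Real.sin (k * φ) * Real.sin (k * φ + φ));
        Real.sin φ * Real.sin (2 * (k * φ)), -(Real.sin φ * Real.sin (2 * (k * φ) - φ)),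
          Q * Real.sin (k * φ) ^ 2;
        0, 0, Real.sin φ ^ 2] := by
  induction k with
  | zero =>
    ext i j
    fin_cases i <;> fin_cases j <;> simp [sq]
  | succ k ih =>
    have e : ((k + 1 : ℕ) : ℝ) * φ = k * φ + φ := by push_cast; ring
    rw [pow_succ' (rotMatrix _ _), ← Matrix.mul_smul, ih, e]
    generalize (k : ℝ) * φ = x
    have h1 := Real.sin_sq_add_cos_sq φ
    have h2 := Real.sin_sq_add_cos_sq x
    ext i j
    fin_cases i <;> fin_cases j <;>
      simp [rotMatrix, Matrix.mul_apply, Fin.sum_univ_three, mul_add, Real.sin_add, Real.sin_sub,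
        Real.cos_add, Real.sin_two_mul, Real.cos_two_mul'] <;>
      grind

lemma rotMatrix_pow_eq_one {m : ℕ} (hm : 2 ≤ m) (Q : ℝ) :
    rotMatrix (2 * Real.cos (Real.pi / m)) Q ^ m = 1 := by
  have hm0 : (0 : ℝ) < m := by positivity
  have hs : 0 < Real.sin (Real.pi / m) := by
    apply Real.sin_pos_of_pos_of_lt_pi (by positivity)
    rw [div_lt_iff₀ hm0]
    have : (2 : ℝ) ≤ m := by exact_mod_cast hm
    nlinarith [Real.pi_pos]
  have key := sin_sq_smul_rotMatrix_pow (Real.pi / m) Q m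
  rw [mul_div_cancel₀ _ hm0.ne'] at key
  apply smul_right_injective _ (pow_pos hs 2).ne'
  simp only [key]
  have h2 : Real.sin (2 * Real.pi + Real.pi / m) = Real.sin (Real.pi / m) := by
    rw [add_comm, Real.sin_add_two_pi]
  ext i j
  fin_cases i <;> fin_cases j <;> simp [h2, Real.sin_two_pi_sub, sq]

/-- The simple reflections of the geometric representation, in the basis of simple roots. -/
def reflMatrix (P Q : ℝ) : Fin 3 → Matrix (Fin 3) (Fin 3) ℝ :=
  ![!![-1, P, 0; 0, 1, 0; 0, 0, 1], !![1, 0, 0; P, -1, Q; 0, 0, 1],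
    !![1, 0, 0; 0, 1, 0; 0, Q, -1]]

lemma reflMatrix_mul_self (P Q : ℝ) (i : Fin 3) : reflMatrix P Q i * reflMatrix P Q i = 1 := by
  fin_cases i <;> ext i j <;> fin_cases i <;> fin_cases j <;>
    simp [reflMatrix, Matrix.mul_apply, Fin.sum_univ_three]

lemma mul_pow_eq_one_comm_of_mul_self {M : Type*} [Monoid M] {a b : M} (ha : a * a = 1)
    (hb : b * b = 1) {k : ℕ} (h : (a * b) ^ k = 1) : (b * a) ^ k = 1 := by
  have h1 : a * b * (b * a) = 1 := by rw [mul_assoc, ← mul_assoc b, hb, one_mul, ha]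
  have h2 : b * a * (a * b) = 1 := by rw [mul_assoc, ← mul_assoc a, ha, one_mul, hb]
  have hc : Commute (a * b) (b * a) := h1.trans h2.symm
  simpa [h, h1] using (hc.mul_pow k).symm

lemma reflMatrix_zero_mul_one (P Q : ℝ) :
    reflMatrix P Q 0 * reflMatrix P Q 1 = rotMatrix P Q := by
  ext i j
  fin_cases i <;> fin_cases j <;>
    simp [reflMatrix, rotMatrix, Matrix.mul_apply, Fin.sum_univ_three] <;> ring

lemma reflMatrix_two_mul_one (P Q : ℝ) :
    reflMatrix P Q 2 * reflMatrix P Q 1 =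
      Matrix.reindexAlgEquiv ℝ ℝ (Equiv.swap 0 2) (rotMatrix Q P) := by
  have h1 : Equiv.swap (0 : Fin 3) 2 1 = 1 := by decide
  ext i j
  fin_cases i <;> fin_cases j <;>
    simp [reflMatrix, rotMatrix, Matrix.mul_apply, Fin.sum_univ_three, h1] <;> ring

lemma reflMatrix_zero_mul_two_sq (P Q : ℝ) :
    (reflMatrix P Q 0 * reflMatrix P Q 2) ^ 2 = 1 := by
  ext i j
  fin_cases i <;> fin_cases j <;>
    simp [reflMatrix, sq, Matrix.mul_apply, Fin.sum_univ_three]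

lemma isLiftable_reflMatrix (m n : ℕ) (hm : 2 ≤ m) (hn : 2 ≤ n) :
    (cox3 m n hm hn).IsLiftable
      (reflMatrix (2 * Real.cos (Real.pi / m)) (2 * Real.cos (Real.pi / n))) := by
  set P := 2 * Real.cos (Real.pi / m) with hP
  set Q := 2 * Real.cos (Real.pi / n) with hQ
  have hs := reflMatrix_mul_self P Q
  have h01 : (reflMatrix P Q 0 * reflMatrix P Q 1) ^ m = 1 := by
    rw [reflMatrix_zero_mul_one, hP, rotMatrix_pow_eq_one hm]
  have h21 : (reflMatrix P Q 2 * reflMatrix P Q 1) ^ n = 1 := by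
    rw [reflMatrix_two_mul_one, ← map_pow, hQ, rotMatrix_pow_eq_one hn, map_one]
  have h02 := reflMatrix_zero_mul_two_sq P Q
  have h10 := mul_pow_eq_one_comm_of_mul_self (hs 0) (hs 1) h01
  have h12 := mul_pow_eq_one_comm_of_mul_self (hs 2) (hs 1) h21
  have h20 := mul_pow_eq_one_comm_of_mul_self (hs 0) (hs 2) h02
  intro i j
  fin_cases i <;> fin_cases j
  · exact (pow_one _).trans (hs 0)
  · exact h01
  · exact h02
  · exact h10
  · exact (pow_one _).trans (hs 1)
  · exact h12
  · exact h20
  · exact h21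
  · exact (pow_one _).trans (hs 2)

lemma pos_and_lt_succ_of_recurrence {t : ℝ} (ht : 2 ≤ t) {u : ℕ → ℝ} (h0 : u 0 = 0)
    (h1 : 0 < u 1) (hu : ∀ k, u (k + 2) = t * u (k + 1) - u k) (k : ℕ) :
    0 < u (k + 1) ∧ u k < u (k + 1) := by
  induction k with
  | zero => simpa [h0] using h1
  | succ k ih =>
    have := hu k
    constructor <;> nlinarith

lemma reflMatrix_prod_pow_ne_one {P Q : ℝ} (hP : 0 < P) (hQ : 0 < Q) (h : 4 ≤ P ^ 2 + Q ^ 2)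
    (k : ℕ) : (reflMatrix P Q 0 * reflMatrix P Q 1 * reflMatrix P Q 2) ^ (k + 1) ≠ 1 := by
  set w := reflMatrix P Q 0 * reflMatrix P Q 1 * reflMatrix P Q 2 with hw
  have hw' : w = !![P ^ 2 - 1, P * (Q ^ 2 - 1), -(P * Q); P, Q ^ 2 - 1, -Q; 0, Q, -1] := by
    rw [hw, reflMatrix_zero_mul_one]
    ext i j
    fin_cases i <;> fin_cases j <;>
      simp [reflMatrix, rotMatrix, Matrix.mul_apply, Fin.sum_univ_three] <;> ring
  clear_value w
  have hrec : w * w * (w + 1) = (P ^ 2 + Q ^ 2 - 2) • (w * (w + 1)) - (w + 1) := by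
    rw [hw', Matrix.one_fin_three]
    ext i j
    fin_cases i <;> fin_cases j <;>
      simp <;> ring
  have hpos := (pos_and_lt_succ_of_recurrence (t := P ^ 2 + Q ^ 2 - 2) (by linarith)
    (u := fun k => (w ^ k * (w + 1)) 2 0) (by simp [hw']) ?_ ?_ k).1
  · intro hk
    rw [hk] at hpos
    simp [hw'] at hpos
  · simp [hw', Matrix.mul_apply, Fin.sum_univ_three]
    positivity
  · intro k
    have : w ^ (k + 2) * (w + 1) =
        (P ^ 2 + Q ^ 2 - 2) • (w ^ (k + 1) * (w + 1)) - w ^ k * (w + 1) := by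
      rw [pow_add, sq, mul_assoc, hrec, mul_sub, Matrix.mul_smul, pow_succ w, mul_assoc]
    simp only [this, Matrix.sub_apply, Matrix.smul_apply, smul_eq_mul]

lemma three_le_of_one_div_add_le {m n : ℕ} (hm : 2 ≤ m) (hn : 2 ≤ n)
    (h : (1 : ℝ) / m + 1 / n + 1 / 2 ≤ 1) : 3 ≤ m := by
  by_contra hlt
  obtain rfl : m = 2 := by omega
  have : (0 : ℝ) < 1 / n := by positivity
  push_cast at h
  linarith

lemma cos_pi_div_pos {m : ℕ} (hm : 3 ≤ m) : 0 < Real.cos (Real.pi / m) := by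
  have : (3 : ℝ) ≤ m := by exact_mod_cast hm
  have hpi := Real.pi_pos
  apply Real.cos_pos_of_mem_Ioo
  have h0 : 0 < Real.pi / m := by positivity
  refine ⟨by linarith, ?_⟩
  gcongr
  linarith

lemma one_le_cos_sq_add_cos_sq {x y : ℝ} (hx : 0 ≤ x) (hy : 0 ≤ y)
    (hxy : x + y ≤ Real.pi / 2) : 1 ≤ Real.cos x ^ 2 + Real.cos y ^ 2 := by
  have hs : 0 ≤ Real.sin x := Real.sin_nonneg_of_nonneg_of_le_pi hx (by linarith [Real.pi_pos])
  have hle : Real.sin x ≤ Real.cos y := by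
    rw [← Real.cos_pi_div_two_sub]
    exact Real.cos_le_cos_of_nonneg_of_le_pi hy (by linarith [Real.pi_pos]) (by linarith)
  nlinarith [Real.sin_sq_add_cos_sq x]

/-- If `1/m + 1/n + 1/2 ≤ 1` then the product `a·b·c` of the three
standard generators of the `(m,n,2)` triangle Coxeter group has infinite order. -/
theorem coxeter_mn2_abc_infinite_order (m n : ℕ) (hm : 2 ≤ m) (hn : 2 ≤ n)
    (h : (1:ℝ)/(m:ℝ) + 1/(n:ℝ) + 1/2 ≤ 1) :
    ¬ IsOfFinOrder ((cox3 m n hm hn).simple 0 * (cox3 m n hm hn).simple 1 *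
      (cox3 m n hm hn).simple 2) := by
  have hm3 := three_le_of_one_div_add_le hm hn h
  have hn3 := three_le_of_one_div_add_le hn hm (by linarith)
  have hsq : 1 ≤ Real.cos (Real.pi / m) ^ 2 + Real.cos (Real.pi / n) ^ 2 := by
    apply one_le_cos_sq_add_cos_sq (by positivity) (by positivity)
    have := mul_le_mul_of_nonneg_left h Real.pi_pos.le
    simp only [mul_add, mul_one_div] at this
    linarith
  rw [isOfFinOrder_iff_pow_eq_one]
  rintro ⟨k, hk, hpow⟩
  obtain ⟨k, rfl⟩ := Nat.exists_eq_add_of_lt hk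
  have hlift := isLiftable_reflMatrix m n hm hn
  have himg := congrArg ((cox3 m n hm hn).toCoxeterSystem.lift ⟨_, hlift⟩) hpow
  have happ (i : Fin 3) := (cox3 m n hm hn).toCoxeterSystem.lift_apply_simple hlift i
  rw [CoxeterMatrix.toCoxeterSystem_simple] at happ
  rw [map_pow, map_mul, map_mul, happ, happ, happ, map_one, zero_add] at himg
  exact reflMatrix_prod_pow_ne_one (by have := cos_pi_div_pos hm3; positivity)
    (by have := cos_pi_div_pos hn3; positivity) (by nlinarith) k himg
end
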